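/- Let rho be any integer such that F(p,rho) is non-empty and let w be in F(p,rho). Then for every q in F(p) one has m_w <= max{rho+2, m_q+1}. If moreover q belongs to F(p,rho), then: (i) m_q < m_w if and only if m_q = rho+1, m_w = rho+2 and q(rho-1) < w(rho-1); (ii) either the set M(p,rho) has exactly one element or M(p,rho) = {rho+1, rho+2}; (iii) m^rho_{p} >= m_{f^rho_{p}}, and m^rho_{p} = m_{f^rho_{p}} if f^rho_{p} has regularity rho, while m^rho_{p} = m_{g^rho_{p}} otherwise. -/

import Mathlib

open scoped Classical

noncomputable section

/-! ## Binomial expansions and the Macaulay operations `(a_t)^+_+` and `(a_t)^-_-` -/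

/-- The largest `k` such that `C(k,t) ≤ a` (top coefficient of the greedy binomial
expansion of `a` in base `t`). -/
def expTop (a t : ℕ) : ℕ := Nat.findGreatest (fun k => Nat.choose k t ≤ a) (a + t + 1)

/-- `(a_t)^+_+` : if `a = C(k(t),t) + ... + C(k(j),j)` is the binomial expansion of `a`
in base `t`, then `plusPlus a t = C(k(t)+1,t+1) + ... + C(k(j)+1,j+1)`; it sends `0` to `0`. -/
def plusPlus : ℕ → ℕ → ℕ
  | _, 0 => 0
  | a, t + 1 =>
    if a = 0 then 0
    else Nat.choose (expTop a (t + 1) + 1) (t + 2) +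
      plusPlus (a - Nat.choose (expTop a (t + 1)) (t + 1)) t

/-- `(a_t)^-_-` : if `a = C(k(t),t) + ... + C(k(j),j)` is the binomial expansion of `a`
in base `t`, then `minusMinus a t = C(k(t)-1,t-1) + ... + C(k(j)-1,j-1)`; it sends `0` to `0`. -/
def minusMinus : ℕ → ℕ → ℕ
  | _, 0 => 0
  | a, t + 1 =>
    if a = 0 then 0
    else Nat.choose (expTop a (t + 1) - 1) t +
      minusMinus (a - Nat.choose (expTop a (t + 1)) (t + 1)) t

/-! ## Numerical functions -/

/-- A numerical function (modelled with values in `ℤ`) is *admissible* (an O-sequence) if it is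
nonnegative, `H 0 = 1` and `H (t+1) ≤ (H(t)_t)^+_+` for every `t ≥ 1`. -/
def OSeq (H : ℕ → ℤ) : Prop :=
  (∀ t, 0 ≤ H t) ∧ H 0 = 1 ∧ ∀ t, 1 ≤ t → H (t + 1) ≤ (plusPlus (H t).toNat t : ℤ)

/-- First derivative of a numerical function: `Δf(0) = 1`, `Δf(t) = f(t) - f(t-1)`. -/
def nderiv (f : ℕ → ℤ) : ℕ → ℤ
  | 0 => 1
  | t + 1 => f (t + 1) - f t

/-- Integral of a numerical function: `Σg(0) = 1`, `Σg(t) = Σg(t-1) + g(t)`. -/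
def ninteg (g : ℕ → ℤ) : ℕ → ℤ
  | 0 => 1
  | t + 1 => ninteg g t + g (t + 1)

/-! ## Admissible Hilbert polynomials in Gotzmann form -/

/-- The integer-valued binomial coefficient `C(a,k)` for `a : ℤ`, agreeing with the
polynomial binomial coefficient `a(a-1)⋯(a-k+1)/k!`. -/
def zchoose (a : ℤ) (k : ℕ) : ℤ :=
  if 0 ≤ a then (a.toNat.choose k : ℤ)
  else (-1) ^ k * (((k : ℤ) - 1 - a).toNat.choose k : ℤ)

/-- An admissible Hilbert polynomial, recorded through its Gotzmann form
`p(z) = C(z+k₁,k₁) + C(z+k₂-1,k₂) + ... + C(z+k_r-(r-1),k_r)` with `k₁ ≥ k₂ ≥ ... ≥ k_r ≥ 0`. -/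
structure GotzmannPoly where
  ks : List ℕ
  sorted : ks.Pairwise (· ≥ ·)

namespace GotzmannPoly

/-- The Gotzmann number `r` of `p`. -/
def r (p : GotzmannPoly) : ℕ := p.ks.length

/-- The degree of `p`, namely `k₁`. -/
def degree (p : GotzmannPoly) : ℕ := p.ks.headD 0

/-- Evaluation of `p` at an integer. -/
def eval (p : GotzmannPoly) (z : ℤ) : ℤ :=
  ∑ i ∈ Finset.range p.r, zchoose (z + (p.ks.getD i 0 : ℤ) - i) (p.ks.getD i 0)

/-- The first difference `Δp(z) = p(z) - p(z-1)`, in Gotzmann form. -/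
def delta (p : GotzmannPoly) : GotzmannPoly where
  ks := (p.ks.filter fun k => 1 ≤ k).map fun k => k - 1
  sorted := by
    refine List.Pairwise.map _ (fun {a b} h => Nat.sub_le_sub_right h 1) ?_
    exact p.sorted.filter _

/-- Iterated first difference `Δ^i p`. -/
def deltaIter (p : GotzmannPoly) (i : ℕ) : GotzmannPoly := delta^[i] p

/-- The polynomial `p(z) + c`, in Gotzmann form. -/
def addConst (p : GotzmannPoly) (c : ℕ) : GotzmannPoly where
  ks := p.ks ++ List.replicate c 0
  sorted := by
    rw [List.pairwise_append]
    refine ⟨p.sorted, ?_, ?_⟩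
    · exact List.pairwise_replicate.2 (Or.inr le_rfl)
    · intro a _ b hb
      rw [List.eq_of_mem_replicate hb]
      exact Nat.zero_le a

end GotzmannPoly

/-- The set `Π_p = {1 ≤ t ≤ r : (p(t+h)_{t+h})^+_+ ≥ p(t+h+1) ≥ 1 for all h ≥ 0}`. -/
def PiSet (p : GotzmannPoly) : Set ℕ :=
  {t | 1 ≤ t ∧ t ≤ p.r ∧ ∀ h : ℕ,
      p.eval ((t : ℤ) + (h : ℤ) + 1) ≤ (plusPlus (p.eval ((t : ℤ) + (h : ℤ))).toNat (t + h) : ℤ) ∧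
      1 ≤ p.eval ((t : ℤ) + (h : ℤ) + 1)}

/-- `ρ_p`: `0` if `min Π_p = 1` and `p(0) = 1`, and `min Π_p` otherwise. -/
def rhoP (p : GotzmannPoly) : ℕ :=
  if sInf (PiSet p) = 1 ∧ p.eval 0 = 1 then 0 else sInf (PiSet p)

/-- The minimal function `f^ρ_p` : `f(t) = p(t)` for `t ≥ ρ` and
`f(t) = ((f(t+1))_{t+1})^-_-` for `t < ρ`. -/
def fmin (p : GotzmannPoly) (ρ : ℕ) (t : ℕ) : ℤ :=
  if h : ρ ≤ t then p.eval (t : ℤ)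
  else (minusMinus (fmin p ρ (t + 1)).toNat (t + 1) : ℤ)
termination_by ρ - t
decreasing_by omega

/-- The function `g^ρ_p` : `g(t) = p(t)` for `t ≥ ρ`, `g(ρ-1) = p(ρ-1) + 1` and
`g(t) = ((g(t+1))_{t+1})^-_-` for `t < ρ-1`. -/
def gmin (p : GotzmannPoly) (ρ : ℕ) (t : ℕ) : ℤ :=
  if h : ρ ≤ t then p.eval (t : ℤ)
  else if t = ρ - 1 then p.eval (t : ℤ) + 1
  else (minusMinus (gmin p ρ (t + 1)).toNat (t + 1) : ℤ)
termination_by ρ - t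
decreasing_by omega

/-- `H` has regularity `ρ` (with respect to the Hilbert polynomial `p`): `ρ` is the least
integer such that `H(t) = p(t)` for all `t ≥ ρ`. -/
def IsRegOf (p : GotzmannPoly) (H : ℕ → ℤ) (ρ : ℕ) : Prop :=
  (∀ t : ℕ, ρ ≤ t → H t = p.eval (t : ℤ)) ∧
  ∀ ρ' : ℕ, (∀ t : ℕ, ρ' ≤ t → H t = p.eval (t : ℤ)) → ρ ≤ ρ'

/-- `H` has Hilbert polynomial `p`, i.e. eventually agrees with `p`. -/
def HasHP (p : GotzmannPoly) (H : ℕ → ℤ) : Prop :=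
  ∃ N : ℕ, ∀ t : ℕ, N ≤ t → H t = p.eval (t : ℤ)

/-- `F(p,ρ)`: the set of Hilbert functions of closed projective subschemes (i.e. numerical
functions which are admissible together with their first derivative) with Hilbert
polynomial `p` and regularity `ρ`. -/
def Fset (p : GotzmannPoly) (ρ : ℕ) : Set (ℕ → ℤ) :=
  {H | OSeq H ∧ OSeq (nderiv H) ∧ IsRegOf p H ρ}

/-- `ρ̄_p`: the minimal `ρ` such that `F(p,ρ)` is non-empty. -/
def rhobar (p : GotzmannPoly) : ℕ := sInf {ρ | (Fset p ρ).Nonempty}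

/-! ## Monomial ideals in `K[x₀,…,xₙ]` (combinatorial model) -/

/-- Monomials of `K[x₀,…,xₙ]`, as exponent vectors. -/
abbrev Mon (n : ℕ) := Fin (n + 1) → ℕ

/-- Degree of a monomial. -/
def mdeg {n : ℕ} (m : Mon n) : ℕ := ∑ i, m i

/-- `T_t`, the set of terms of degree `t`. -/
def Tset (n t : ℕ) : Set (Mon n) := {m | mdeg m = t}

/-- A set of monomials closed under multiplication by arbitrary monomials (a monomial ideal). -/
def MonIdeal {n : ℕ} (J : Set (Mon n)) : Prop :=
  ∀ m ∈ J, ∀ m' : Mon n, m + m' ∈ J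

/-- The elementary Borel move sending `x^m` to `x_i · x^m / x_j`. -/
def borelStep {n : ℕ} (m : Mon n) (j i : Fin (n + 1)) : Mon n :=
  fun l => if l = j then m l - 1 else if l = i then m l + 1 else m l

/-- One elementary Borel move `x_j ↦ x_i` with `j < i`. -/
def borelMove {n : ℕ} (a b : Mon n) : Prop :=
  ∃ j i : Fin (n + 1), j < i ∧ 1 ≤ a j ∧ b = borelStep a j i

/-- The Borel (partial) order `≤_B` on monomials. -/
def borelLE {n : ℕ} : Mon n → Mon n → Prop := Relation.ReflTransGen borelMove

/-- A strongly stable (Borel) monomial ideal. -/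
def StronglyStable {n : ℕ} (J : Set (Mon n)) : Prop :=
  MonIdeal J ∧ ∀ m ∈ J, ∀ j i : Fin (n + 1), j < i → 1 ≤ m j → borelStep m j i ∈ J

/-- A Borel set in `T_t`: a set of degree-`t` monomials closed upwards under `≤_B`. -/
def IsBorelSet {n : ℕ} (t : ℕ) (B : Set (Mon n)) : Prop :=
  B ⊆ Tset n t ∧ ∀ a ∈ B, ∀ b : Mon n, borelLE a b → b ∈ B

/-- Saturation of a monomial ideal:
`J^sat = {m : for every i there is k with x_i^k · m ∈ J}`. -/
def monSat {n : ℕ} (J : Set (Mon n)) : Set (Mon n) :=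
  {m | ∀ i : Fin (n + 1), ∃ k : ℕ, (fun l => if l = i then m l + k else m l) ∈ J}

/-- The monomial ideal generated by a set of monomials. -/
def genIdeal {n : ℕ} (B : Set (Mon n)) : Set (Mon n) :=
  {m | ∃ b ∈ B, ∃ c : Mon n, m = b + c}

/-- The Hilbert function of `S/J` for a monomial ideal `J`: the number of degree-`t`
monomials outside `J`. -/
def hilb {n : ℕ} (J : Set (Mon n)) (t : ℕ) : ℕ :=
  Set.ncard {m : Mon n | mdeg m = t ∧ m ∉ J}

/-- `m / x_i` as an exponent vector. -/
def shrinkAt {n : ℕ} (m : Mon n) (i : Fin (n + 1)) : Mon n :=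
  fun l => if l = i then m l - 1 else m l

/-- `m` is a minimal (monomial) generator of the monomial ideal `J`. -/
def IsMinGen {n : ℕ} (J : Set (Mon n)) (m : Mon n) : Prop :=
  m ∈ J ∧ ∀ i : Fin (n + 1), 1 ≤ m i → shrinkAt m i ∉ J

/-- The Castelnuovo–Mumford regularity of a strongly stable ideal: the maximal degree of a
minimal monomial generator. -/
def monReg {n : ℕ} (J : Set (Mon n)) : ℕ :=
  sSup {d | ∃ m : Mon n, IsMinGen J m ∧ mdeg m = d}

/-- `m_u`: the minimal Castelnuovo–Mumford regularity of a closed projective subscheme with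
Hilbert function `u`, i.e. the minimum of `reg J` over all `n` and all saturated strongly
stable ideals `J ⊆ K[x₀,…,xₙ]` with `H_{S/J} = u`. -/
def mReg (u : ℕ → ℤ) : ℕ :=
  sInf {r | ∃ (n : ℕ) (J : Set (Mon n)), StronglyStable J ∧ monSat J = J ∧
      (∀ t : ℕ, (hilb J t : ℤ) = u t) ∧ monReg J = r}

/-- `M(p,ρ) = {m_u : u ∈ F(p,ρ)}`. -/
def Mset (p : GotzmannPoly) (ρ : ℕ) : Set ℕ := {r | ∃ u ∈ Fset p ρ, mReg u = r}

/-- `m^ρ_p = min M(p,ρ)`. -/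
def mRho (p : GotzmannPoly) (ρ : ℕ) : ℕ := sInf (Mset p ρ)

/-- `m_p`: the minimal Castelnuovo–Mumford regularity of schemes with Hilbert polynomial `p`. -/
def mP (p : GotzmannPoly) : ℕ := sInf {r | ∃ ρ : ℕ, ∃ u ∈ Fset p ρ, mReg u = r}

/-! ## Lex segments and growth-height-lexicographic Borel sets -/

/-- `a` is smaller than `b` in the deglex order (for monomials of the same degree):
`a k < b k` where `k` is the largest index where they differ. -/
def deglexLT {n : ℕ} (a b : Mon n) : Prop :=
  ∃ k : Fin (n + 1), a k < b k ∧ ∀ l : Fin (n + 1), k < l → a l = b l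

/-- A lex-segment of `T_t`: a set of degree-`t` monomials consisting of the highest terms
with respect to deglex. -/
def IsLexSeg {n : ℕ} (t : ℕ) (L : Set (Mon n)) : Prop :=
  L ⊆ Tset n t ∧ ∀ a ∈ L, ∀ b ∈ Tset n t, deglexLT a b → b ∈ L

/-- A lex-segment in `A ⊆ T_t`: the intersection of a lex-segment of `T_t` with `A`. -/
def LexSegIn {n : ℕ} (t : ℕ) (A S : Set (Mon n)) : Prop :=
  ∃ L : Set (Mon n), IsLexSeg t L ∧ S = L ∩ A

/-- The growth class `B^{(i)} = {m ∈ B : min(m) = i}`. -/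
def growthClass {n : ℕ} (B : Set (Mon n)) (i : Fin (n + 1)) : Set (Mon n) :=
  {m | m ∈ B ∧ 1 ≤ m i ∧ ∀ j : Fin (n + 1), j < i → m j = 0}

/-- The height class `B(i) = {m ∈ B : the exponent of x₀ in m is i}`. -/
def heightClass {n : ℕ} (B : Set (Mon n)) (i : ℕ) : Set (Mon n) :=
  {m | m ∈ B ∧ m 0 = i}

/-- A Borel set `B ⊆ T_t` is growth-lexicographic if all its growth classes are lex-segments
in the corresponding growth classes of `T_t`. -/
def GrowthLex {n : ℕ} (t : ℕ) (B : Set (Mon n)) : Prop :=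
  ∀ i : Fin (n + 1), LexSegIn t (growthClass (Tset n t) i) (growthClass B i)

/-- A Borel set `B ⊆ T_t` is growth-height-lexicographic if `B(0)` is growth-lexicographic
and `B(i)` is a lex-segment in `T_t(i)` for every `0 < i ≤ t`. -/
def GHLex {n : ℕ} (t : ℕ) (B : Set (Mon n)) : Prop :=
  GrowthLex t (heightClass B 0) ∧
  ∀ i : ℕ, 0 < i → i ≤ t → LexSegIn t (heightClass (Tset n t) i) (heightClass B i)

end

/-! ## Binomial expansions -/

lemma expTop_eq {a t k : ℕ} (h1 : k.choose (t + 1) ≤ a)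
    (h2 : a < (k + 1).choose (t + 1)) : expTop a (t + 1) = k := by
  have hmono : ∀ l, k < l → a < l.choose (t + 1) := fun l hl =>
    h2.trans_le (Nat.choose_le_choose _ hl)
  unfold expTop
  rw [Nat.findGreatest_eq_iff]
  refine ⟨?_, fun _ => h1, fun l hl _ => by simpa using hmono l hl⟩
  by_contra! hlt
  have h3 : (a + (t + 1) + 1).choose (t + 1) ≤ k.choose (t + 1) :=
    Nat.choose_le_choose _ hlt.le
  have h4 : a + 1 + (t + 1) ≤ k := by omega
  have h5 : (a + 1).succ ≤ (a + 1 + (t + 1)).choose (t + 1) := by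
    have : ∀ u, (a + 1).succ ≤ (a + 1 + (u + 1)).choose (u + 1) := by
      intro u
      induction u with
      | zero => simp
      | succ u ih =>
        rw [← add_assoc, Nat.choose_succ_succ]
        rw [← add_assoc] at ih ⊢
        omega
    exact this t
  have h6 : (a + 1 + (t + 1)).choose (t + 1) ≤ k.choose (t + 1) := Nat.choose_le_choose _ h4
  omega

lemma exists_top (t : ℕ) {a : ℕ} (ha : 0 < a) :
    ∃ k a', t ≤ k ∧ a' < (k + 1).choose t ∧ a = (k + 1).choose (t + 1) + a' := by
  have hex : ∃ k, a < (k + 1).choose (t + 1) := by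
    refine ⟨a + t, ?_⟩
    induction t with
    | zero => simp
    | succ t ih =>
      rw [← add_assoc, Nat.choose_succ_succ]
      omega
  set k := Nat.find hex with hk
  have h1 : a < (k + 1).choose (t + 1) := Nat.find_spec hex
  have h2 : t < k := by
    by_contra! h
    rcases h.lt_or_eq with h | h
    · rw [Nat.choose_eq_zero_of_lt (by omega)] at h1; omega
    · rw [h, Nat.choose_self] at h1; omega
  obtain ⟨l, hl⟩ : ∃ l, k = l + 1 := ⟨k - 1, by omega⟩
  have h3 := Nat.find_min hex (m := l) (by omega)
  rw [hl, Nat.choose_succ_succ'] at h1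
  exact ⟨l, a - (l + 1).choose (t + 1), by omega, by omega, by omega⟩

/-- Number of terms of the complement of a lex-segment not divisible by the last variable:
`(a_t)` restricted to a hyperplane. -/
def green (a t : ℕ) : ℕ := a - minusMinus a t

section TopTerm

variable {t k a : ℕ}

lemma expTop_top (ha : a < (k + 1).choose t) :
    expTop ((k + 1).choose (t + 1) + a) (t + 1) = k + 1 :=
  expTop_eq (by omega) (by rw [Nat.choose_succ_succ' (k + 1)]; omega)

lemma plusPlus_top (hk : t ≤ k) (ha : a < (k + 1).choose t) :
    plusPlus ((k + 1).choose (t + 1) + a) (t + 1) =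
      (k + 2).choose (t + 2) + plusPlus a t := by
  have := Nat.choose_pos (show t + 1 ≤ k + 1 by omega)
  rw [plusPlus, if_neg (by omega), expTop_top ha, Nat.add_sub_cancel_left]

lemma minusMinus_top (hk : t ≤ k) (ha : a < (k + 1).choose t) :
    minusMinus ((k + 1).choose (t + 1) + a) (t + 1) =
      k.choose t + minusMinus a t := by
  have := Nat.choose_pos (show t + 1 ≤ k + 1 by omega)
  rw [minusMinus, if_neg (by omega), expTop_top ha, Nat.add_sub_cancel_left,
    Nat.add_sub_cancel]

@[simp] lemma plusPlus_zero_left (t : ℕ) : plusPlus 0 t = 0 := by cases t <;> simp [plusPlus]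

@[simp] lemma minusMinus_zero_left (t : ℕ) : minusMinus 0 t = 0 := by
  cases t <;> simp [minusMinus]

@[simp] lemma minusMinus_zero_right (a : ℕ) : minusMinus a 0 = 0 := by simp [minusMinus]

@[simp] lemma green_zero_left (t : ℕ) : green 0 t = 0 := by simp [green]

@[simp] lemma green_zero_right (a : ℕ) : green a 0 = a := by simp [green]

lemma minusMinus_le (t a : ℕ) : minusMinus a t ≤ a := by
  induction t generalizing a with
  | zero => simp
  | succ t ih =>
    rcases Nat.eq_zero_or_pos a with rfl | ha
    · simp
    · obtain ⟨k, a', hk, ha', rfl⟩ := exists_top t ha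
      rw [minusMinus_top hk ha', Nat.choose_succ_succ]
      have := ih a'
      omega

lemma green_add_minusMinus (t a : ℕ) : green a t + minusMinus a t = a :=
  Nat.sub_add_cancel (minusMinus_le t a)

lemma green_top (hk : t ≤ k) (ha : a < (k + 1).choose t) :
    green ((k + 1).choose (t + 1) + a) (t + 1) = k.choose (t + 1) + green a t := by
  have h1 := green_add_minusMinus (t + 1) ((k + 1).choose (t + 1) + a)
  have h2 := green_add_minusMinus t a
  rw [minusMinus_top hk ha] at h1
  have h3 := Nat.choose_succ_succ' k t
  omega

lemma minusMinus_one (ha : 0 < a) : minusMinus a 1 = 1 := by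
  obtain ⟨k, a', hk, ha', rfl⟩ := exists_top 0 ha
  rw [minusMinus_top hk ha']; simp

lemma plusPlus_lt (hk : t ≤ k) (ha : a < k.choose t) :
    plusPlus a t < (k + 1).choose (t + 1) := by
  induction t generalizing k a with
  | zero => simp [plusPlus]
  | succ t ih =>
    rcases Nat.eq_zero_or_pos a with rfl | ha0
    · simpa using Nat.choose_pos (show t + 2 ≤ k + 1 by omega)
    · obtain ⟨l, a', hl, ha', rfl⟩ := exists_top t ha0
      have hlk : l + 2 ≤ k := by
        by_contra! h
        have := Nat.choose_le_choose (t + 1) (show k ≤ l + 1 by omega)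
        omega
      rw [plusPlus_top hl ha']
      have h1 := ih (by omega) ha'
      have h2 := Nat.choose_le_choose (t + 2) (show l + 3 ≤ k + 1 by omega)
      have h3 := Nat.choose_succ_succ' (l + 2) (t + 1)
      simp only [Nat.add_assoc, Nat.reduceAdd] at *
      omega

lemma minusMinus_le_choose (hk : t ≤ k) (ha : a < (k + 1).choose (t + 1)) :
    minusMinus a (t + 1) ≤ k.choose t := by
  induction t generalizing k a with
  | zero =>
    rcases Nat.eq_zero_or_pos a with rfl | ha0
    · simp
    · simp [minusMinus_one ha0]
  | succ t ih =>
    rcases Nat.eq_zero_or_pos a with rfl | ha0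
    · simp
    · obtain ⟨l, a', hl, ha', rfl⟩ := exists_top (t + 1) ha0
      have hlk : l + 1 ≤ k := by
        by_contra! h
        have := Nat.choose_le_choose (t + 1 + 1) (show k + 1 ≤ l + 1 by omega)
        omega
      rw [minusMinus_top hl ha']
      have h1 := ih (by omega) ha'
      have h2 := Nat.choose_le_choose (t + 1) hlk
      have h3 := Nat.choose_succ_succ' l t
      simp only [Nat.add_assoc, Nat.reduceAdd] at *
      omega

lemma green_lt (hk : t ≤ k) (ha : a < (k + 1).choose t) : green a t < k.choose t := by
  induction t generalizing k a with
  | zero => simpa using ha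
  | succ t ih =>
    rcases Nat.eq_zero_or_pos a with rfl | ha0
    · simpa using Nat.choose_pos hk
    · obtain ⟨l, a', hl, ha', rfl⟩ := exists_top t ha0
      have hlk : l + 1 ≤ k := by
        by_contra! h
        have := Nat.choose_le_choose (t + 1) (show k + 1 ≤ l + 1 by omega)
        omega
      rw [green_top hl ha']
      have h1 := ih hl ha'
      have h2 := Nat.choose_le_choose (t + 1) hlk
      have h3 := Nat.choose_succ_succ' l t
      omega

end TopTerm

/-- `(·)^-_-` and `(·)^+_+` form a Galois connection. -/
lemma minusMinus_le_iff {t a b : ℕ} (h : 1 ≤ t ∨ b = 0) :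
    minusMinus a (t + 1) ≤ b ↔ a ≤ plusPlus b t := by
  induction t generalizing a b with
  | zero =>
    obtain rfl : b = 0 := by omega
    rcases Nat.eq_zero_or_pos a with rfl | ha
    · simp
    · simp [minusMinus_one ha]; omega
  | succ t ih =>
    rcases Nat.eq_zero_or_pos a with rfl | ha0
    · simp
    obtain ⟨k, a', hk, ha', rfl⟩ := exists_top (t + 1) ha0
    rw [minusMinus_top hk ha']
    have hkpos := Nat.choose_pos hk
    have hkpos' := Nat.choose_pos (show t + 1 + 1 ≤ k + 1 by omega)
    rcases Nat.eq_zero_or_pos b with rfl | hb0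
    · simp only [plusPlus_zero_left]; omega
    obtain ⟨l, b', hl, hb', rfl⟩ := exists_top t hb0
    rw [plusPlus_top hl hb']
    have hP := plusPlus_lt (show t ≤ l + 1 by omega) hb'
    have hM := minusMinus_le_choose (show t ≤ k by omega) ha'
    have e1 := Nat.choose_succ_succ' (k + 1) (t + 1)
    have e2 := Nat.choose_succ_succ' k t
    have e3 := Nat.choose_succ_succ' (l + 1) t
    have e4 := Nat.choose_succ_succ' (l + 2) (t + 1)
    rcases lt_trichotomy k (l + 1) with hlt | heq | hgt
    · have h1 := Nat.choose_le_choose (t + 2) (show k + 1 + 1 ≤ l + 2 by omega)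
      have h2 := Nat.choose_le_choose (t + 1) (show k + 1 ≤ l + 1 by omega)
      simp only [Nat.add_assoc, Nat.reduceAdd] at *
      constructor <;> intro <;> omega
    · subst heq
      rw [Nat.add_le_add_iff_left, Nat.add_le_add_iff_left, ih]
      rcases Nat.eq_zero_or_pos t with rfl | ht
      · right; simpa using hb'
      · exact Or.inl ht
    · have h1 := Nat.choose_le_choose (t + 2) (show l + 2 + 1 ≤ k + 1 by omega)
      have h2 := Nat.choose_le_choose (t + 1) (show l + 1 + 1 ≤ k by omega)
      simp only [Nat.add_assoc, Nat.reduceAdd] at *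
      constructor <;> intro <;> omega

lemma plusPlus_mono {t : ℕ} (ht : 1 ≤ t) : Monotone fun a => plusPlus a t := fun _ _ h =>
  (minusMinus_le_iff (Or.inl ht)).1 (((minusMinus_le_iff (Or.inl ht)).2 le_rfl).trans h)

lemma minusMinus_mono (t : ℕ) : Monotone fun a => minusMinus a t := by
  intro a b h
  rcases t with _ | _ | t
  · simp
  · rcases Nat.eq_zero_or_pos a with rfl | ha
    · simp
    · simp [minusMinus_one ha, minusMinus_one (ha.trans_le h)]
  · exact (minusMinus_le_iff (Or.inl (by omega))).2
      (h.trans ((minusMinus_le_iff (Or.inl (by omega))).1 le_rfl))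

lemma green_mono (t : ℕ) : Monotone fun a => green a t := by
  induction t with
  | zero => intro a b h; simpa using h
  | succ t ih =>
    intro a b h
    rcases Nat.eq_zero_or_pos a with rfl | ha
    · simp
    obtain ⟨l, b', hl, hb', rfl⟩ := exists_top t (ha.trans_le h)
    obtain ⟨k, a', hk, ha', rfl⟩ := exists_top t ha
    simp only [green_top hl hb', green_top hk ha']
    have e1 := Nat.choose_succ_succ' k t
    have e2 := Nat.choose_succ_succ' (l + 1) t
    have h3 := green_lt hk ha'
    rcases lt_trichotomy k l with hlt | rfl | hgt
    · have := Nat.choose_le_choose (t + 1) (show k + 1 ≤ l by omega)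
      omega
    · exact Nat.add_le_add_left (ih (by omega)) _
    · have := Nat.choose_le_choose (t + 1) (show l + 1 + 1 ≤ k + 1 by omega)
      omega

lemma green_plusPlus {t : ℕ} (a : ℕ) (ht : 1 ≤ t ∨ a = 0) :
    green (plusPlus a t) (t + 1) = plusPlus (green a t) t := by
  induction t generalizing a with
  | zero => obtain rfl : a = 0 := by omega
            simp
  | succ t ih =>
    rcases Nat.eq_zero_or_pos a with rfl | ha
    · simp
    obtain ⟨k, a', hk, ha', rfl⟩ := exists_top t ha
    have hG := green_lt hk ha'
    have hIH : green (plusPlus a' t) (t + 1) = plusPlus (green a' t) t := by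
      apply ih
      rcases Nat.eq_zero_or_pos t with rfl | ht
      · right; simpa using ha'
      · exact Or.inl ht
    rw [plusPlus_top hk ha', green_top hk ha',
      green_top (by omega) (plusPlus_lt (by omega) ha'), hIH]
    rcases hk.eq_or_lt with rfl | hlt
    · rw [Nat.choose_self, Nat.lt_one_iff] at hG
      simp [hG]
    · obtain ⟨l, rfl⟩ : ∃ l, k = l + 1 := ⟨k - 1, by omega⟩
      rw [plusPlus_top (by omega) hG]

lemma le_plusPlus_minusMinus {t : ℕ} (ht : 1 ≤ t) (a : ℕ) :
    a ≤ plusPlus (minusMinus a (t + 1)) t :=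
  (minusMinus_le_iff (Or.inl ht)).1 le_rfl

/-- The hyperplane restrictions of `a` and `(a_{t+1})^-_-` satisfy Macaulay's inequality. -/
lemma green_le_plusPlus_green {t : ℕ} (ht : 1 ≤ t) (a : ℕ) :
    green a (t + 1) ≤ plusPlus (green (minusMinus a (t + 1)) t) t := by
  rw [← green_plusPlus _ (Or.inl ht)]
  exact green_mono _ (le_plusPlus_minusMinus ht a)

lemma minusMinus_green_le (t a : ℕ) :
    minusMinus (green a (t + 1)) (t + 1) ≤ green (minusMinus a (t + 1)) t := by
  rcases Nat.eq_zero_or_pos t with rfl | ht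
  · simpa using minusMinus_mono 1 (show green a 1 ≤ a from Nat.sub_le a _)
  · exact (minusMinus_le_iff (Or.inl ht)).2 (green_le_plusPlus_green ht a)

lemma le_green_of_minusMinus_le {t b c : ℕ} (h : minusMinus b (t + 1) ≤ green c t) :
    b ≤ green (b + c) (t + 1) := by
  have key : minusMinus (b + c) (t + 1) ≤ c := by
    rcases Nat.eq_zero_or_pos t with rfl | ht
    · rcases Nat.eq_zero_or_pos c with rfl | hc
      · simpa using h
      · rw [zero_add, minusMinus_one (by omega)]; exact hc
    · rw [minusMinus_le_iff (Or.inl ht)] at h ⊢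
      by_contra! hlt
      rw [← green_plusPlus _ (Or.inl ht)] at h
      have h2 := h.trans (green_mono (t + 1) hlt.le)
      have h3 : c < minusMinus (b + c) (t + 1) := by
        rwa [← not_le, minusMinus_le_iff (Or.inl ht), not_le]
      have h4 := green_add_minusMinus (t + 1) (b + c)
      simp only at h2
      omega
  have := green_add_minusMinus (t + 1) (b + c)
  omega

lemma green_multichoose (k t : ℕ) :
    green ((k + 1).multichoose (t + 1)) (t + 1) = k.multichoose (t + 1) := by
  have h1 : (k + 1).multichoose (t + 1) = (k + t + 1).choose (t + 1) + 0 := by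
    rw [Nat.multichoose_eq]; congr 1; omega
  have h2 : k.multichoose (t + 1) = (k + t).choose (t + 1) := by
    rw [Nat.multichoose_eq]; congr 1
  rw [h1, green_top (by omega) (Nat.choose_pos (by omega)), h2]
  simp

lemma green_le_multichoose {k t a : ℕ} (h : a ≤ (k + 1).multichoose (t + 1)) :
    green a (t + 1) ≤ k.multichoose (t + 1) :=
  green_multichoose k t ▸ green_mono _ h

lemma minusMinus_le_multichoose {k t a : ℕ} (h : a ≤ (k + 1).multichoose (t + 1)) :
    minusMinus a (t + 1) ≤ (k + 1).multichoose t := by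
  have h1 := green_add_minusMinus (t + 1) ((k + 1).multichoose (t + 1))
  rw [green_multichoose, Nat.multichoose_succ_succ] at h1
  have := minusMinus_mono (t + 1) h
  simp only [Nat.multichoose_succ_succ] at this
  omega

lemma plusPlus_multichoose (k t : ℕ) :
    plusPlus ((k + 1).multichoose (t + 1)) (t + 1) = (k + 1).multichoose (t + 2) := by
  have h1 : (k + 1).multichoose (t + 1) = (k + t + 1).choose (t + 1) + 0 := by
    rw [Nat.multichoose_eq]; congr 1; omega
  rw [h1, plusPlus_top (by omega) (Nat.choose_pos (by omega)), Nat.multichoose_eq]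
  simp only [plusPlus_zero_left, add_zero]
  congr 1; omega

/-! ## Sets of monomials: sections, colons and counting -/

/-- The degree of a monomial in `k` variables. -/
def deg {k : ℕ} (m : Fin k → ℕ) : ℕ := ∑ i, m i

/-- The variable `x_i` as an exponent vector. -/
def var {k : ℕ} (i : Fin k) : Fin k → ℕ := Pi.single i 1

/-- A monomial, viewed as a monomial with one more (smallest) variable. -/
abbrev consZero {k : ℕ} (m : Fin k → ℕ) : Fin (k + 1) → ℕ := Fin.cons 0 m

/-- The monomials of `N` not divisible by the first variable. -/
def sec {k : ℕ} (N : Set (Fin (k + 1) → ℕ)) : Set (Fin k → ℕ) := {m | consZero m ∈ N}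

/-- The monomials whose product with the first variable lies in `N`. -/
def colon {k : ℕ} (N : Set (Fin (k + 1) → ℕ)) : Set (Fin (k + 1) → ℕ) := {m | m + var 0 ∈ N}

/-- The number of monomials of degree `t` in `N`. -/
noncomputable def cnt {k : ℕ} (N : Set (Fin k → ℕ)) (t : ℕ) : ℕ := Set.ncard {m | deg m = t ∧ m ∈ N}

section Basic

variable {k : ℕ}

@[simp] lemma deg_zero (m : Fin 0 → ℕ) : deg m = 0 := by simp [deg]

@[simp] lemma deg_cons (a : ℕ) (m : Fin k → ℕ) :
    deg (Fin.cons a m : Fin (k + 1) → ℕ) = a + deg m := by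
  simp [deg, Fin.sum_univ_succ]

@[simp] lemma deg_add (m m' : Fin k → ℕ) : deg (m + m') = deg m + deg m' := by
  simp [deg, Finset.sum_add_distrib]

@[simp] lemma deg_var (i : Fin k) : deg (var i) = 1 := by
  simp [deg, var]

lemma cons_add_var (m : Fin k → ℕ) (j : Fin k) :
    consZero m + var j.succ = consZero (m + var j) := by
  funext l
  refine Fin.cases ?_ (fun l => ?_) l
  · simp [var, Fin.succ_ne_zero]
  · by_cases h : l = j <;> simp [var, h]

@[simp] lemma var_self (i : Fin k) : var i i = 1 := by simp [var]

lemma tail_add_var_zero (m : Fin (k + 1) → ℕ) : Fin.tail (m + var 0) = Fin.tail m := by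
  funext l; simp [Fin.tail, var, Fin.succ_ne_zero]

lemma exists_eq_add_var {m : Fin k → ℕ} {i : Fin k} (h : 1 ≤ m i) : ∃ m', m = m' + var i := by
  refine ⟨m - var i, ?_⟩
  rw [tsub_add_cancel_of_le]
  intro l
  by_cases hl : l = i
  · subst hl; simpa [var] using h
  · simp [var, hl]

lemma cons_or_add_var (m : Fin (k + 1) → ℕ) :
    (∃ m' : Fin k → ℕ, m = consZero m') ∨ ∃ m', m = m' + var 0 := by
  rcases Nat.eq_zero_or_pos (m 0) with h | h
  · exact Or.inl ⟨Fin.tail m, by rw [consZero, ← h, Fin.cons_self_tail]⟩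
  · exact Or.inr (exists_eq_add_var h)

lemma finite_deg (t : ℕ) (N : Set (Fin k → ℕ)) : {m | deg m = t ∧ m ∈ N}.Finite := by
  refine (Set.finite_Iic (fun _ : Fin k => t)).subset ?_
  rintro m ⟨rfl, -⟩ i
  exact Finset.single_le_sum (fun _ _ => Nat.zero_le _) (Finset.mem_univ i)

lemma cnt_le {N N' : Set (Fin k → ℕ)} {t : ℕ} (h : ∀ m, deg m = t → m ∈ N → m ∈ N') :
    cnt N t ≤ cnt N' t :=
  Set.ncard_le_ncard (fun m hm => ⟨hm.1, h m hm.1 hm.2⟩) (finite_deg _ _)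

lemma cnt_congr {N N' : Set (Fin k → ℕ)} {t : ℕ} (h : ∀ m, deg m = t → (m ∈ N ↔ m ∈ N')) :
    cnt N t = cnt N' t :=
  (cnt_le fun m hm => (h m hm).1).antisymm (cnt_le fun m hm => (h m hm).2)

lemma cnt_fin_zero_succ (N : Set (Fin 0 → ℕ)) (t : ℕ) : cnt N (t + 1) = 0 := by
  simp [cnt]

lemma cnt_fin_zero_zero {N : Set (Fin 0 → ℕ)} (h : ∀ m, m ∈ N) : cnt N 0 = 1 := by
  simp only [cnt, deg_zero, h, and_self]
  rw [Set.ncard_eq_one]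
  exact ⟨0, by ext m; simp [Subsingleton.elim m 0]⟩

lemma cons_zero_injective : Function.Injective (consZero (k := k)) :=
  fun _ _ h => (Fin.cons_injective2 h).2

lemma cnt_zero_eq (N : Set (Fin (k + 1) → ℕ)) : cnt N 0 = cnt (sec N) 0 := by
  have h : {m | deg m = 0 ∧ m ∈ N} = consZero '' {m | deg m = 0 ∧ m ∈ sec N} := by
    ext m
    constructor
    · rintro ⟨h1, h2⟩
      rcases cons_or_add_var m with ⟨m, rfl⟩ | ⟨m, rfl⟩
      · exact ⟨m, ⟨by simpa using h1, h2⟩, rfl⟩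
      · simp at h1
    · rintro ⟨m, ⟨h1, h2⟩, rfl⟩
      exact ⟨by simpa using h1, h2⟩
  rw [cnt, h, Set.ncard_image_of_injective _ cons_zero_injective]
  rfl

lemma cnt_succ_eq (N : Set (Fin (k + 1) → ℕ)) (t : ℕ) :
    cnt N (t + 1) = cnt (sec N) (t + 1) + cnt (colon N) t := by
  have h : {m | deg m = t + 1 ∧ m ∈ N} =
      consZero '' {m | deg m = t + 1 ∧ m ∈ sec N} ∪
        (· + var 0) '' {m | deg m = t ∧ m ∈ colon N} := by
    ext m
    constructor
    · rintro ⟨h1, h2⟩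
      rcases cons_or_add_var m with ⟨m, rfl⟩ | ⟨m, rfl⟩
      · exact Or.inl ⟨m, ⟨by simpa using h1, h2⟩, rfl⟩
      · exact Or.inr ⟨m, ⟨by simpa using h1, h2⟩, rfl⟩
    · rintro (⟨m, ⟨h1, h2⟩, rfl⟩ | ⟨m, ⟨h1, h2⟩, rfl⟩)
      · exact ⟨by simpa using h1, h2⟩
      · exact ⟨by simpa using h1, h2⟩
  rw [cnt, h, Set.ncard_union_eq ?_ ((finite_deg _ _).image _) ((finite_deg _ _).image _),
    Set.ncard_image_of_injective _ cons_zero_injective,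
    Set.ncard_image_of_injective _ (add_left_injective _)]
  · rfl
  · rw [Set.disjoint_left]
    rintro _ ⟨m, -, rfl⟩ ⟨m', -, h⟩
    have := congrFun h 0
    simp [var] at this

end Basic

/-! ## Complements of strongly stable ideals -/

/-- In degree `d`, the set `N` is closed under replacing a variable by a smaller one. -/
def DownAt {k : ℕ} (d : ℕ) (N : Set (Fin k → ℕ)) : Prop :=
  ∀ m, deg m + 1 = d → ∀ i j, i < j → m + var j ∈ N → m + var i ∈ N

/-- The set `N` is closed under replacing a variable by a smaller one. -/
def Down {k : ℕ} (N : Set (Fin k → ℕ)) : Prop :=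
  ∀ m i j, i < j → m + var j ∈ N → m + var i ∈ N

/-- The set `N` is closed under division by variables. -/
def DivClosed {k : ℕ} (N : Set (Fin k → ℕ)) : Prop := ∀ m i, m + var i ∈ N → m ∈ N

/-- The complement of `N` has no minimal generators of degree greater than `d`. -/
def GenBy {k : ℕ} (N : Set (Fin k → ℕ)) (d : ℕ) : Prop :=
  ∀ m, d < deg m → (∀ m' i, m = m' + var i → m' ∈ N) → m ∈ N

section Stable

variable {k : ℕ}

lemma downAt_succ {t : ℕ} {N : Set (Fin (k + 1) → ℕ)} (h1 : DownAt (t + 1) (sec N))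
    (h2 : DownAt t (colon N))
    (h3 : ∀ m : Fin k → ℕ, deg m = t → ∀ j, m + var j ∈ sec N → m ∈ sec (colon N)) :
    DownAt (t + 1) N := by
  intro m hm i j hij hj
  rcases cons_or_add_var m with ⟨m, rfl⟩ | ⟨m, rfl⟩
  · obtain ⟨j, rfl⟩ := Fin.exists_succ_eq.2 (Fin.ne_zero_of_lt hij)
    rw [cons_add_var] at hj
    have hm' : deg m + 1 = t + 1 := by simpa using hm
    refine Fin.cases (fun _ => ?_) (fun i hij => ?_) i hij
    · exact h3 m (by omega) j hj
    · rw [cons_add_var]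
      exact h1 m hm' i j (Fin.succ_lt_succ_iff.1 hij) hj
  · have hm' : deg m + 1 = t := by simpa using hm
    rw [add_right_comm] at hj ⊢
    exact h2 m hm' i j hij hj

lemma Down.sec {N : Set (Fin (k + 1) → ℕ)} (h : Down N) : Down (sec N) := by
  intro m i j hij hj
  have := h (consZero m) i.succ j.succ (Fin.succ_lt_succ_iff.2 hij)
  rw [cons_add_var, cons_add_var] at this
  exact this hj

lemma Down.colon {N : Set (Fin (k + 1) → ℕ)} (h : Down N) : Down (colon N) := by
  intro m i j hij hj
  have := h (m + var 0) i j hij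
  rw [add_right_comm, add_right_comm m (var 0)] at this
  exact this hj

lemma DivClosed.sec {N : Set (Fin (k + 1) → ℕ)} (h : DivClosed N) : DivClosed (sec N) := by
  intro m i hi
  refine h (consZero m) i.succ ?_
  rw [cons_add_var]; exact hi

lemma GenBy.sec {N : Set (Fin (k + 1) → ℕ)} {d : ℕ} (h : GenBy N d) : GenBy (sec N) d := by
  intro m hm hN
  refine h _ (by simpa using hm) fun m' i hi => ?_
  rcases cons_or_add_var m' with ⟨m', rfl⟩ | ⟨m', rfl⟩
  · revert hi
    refine Fin.cases (fun hi => ?_) (fun i hi => ?_) i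
    · have := congrFun hi 0
      simp [var] at this
    · rw [cons_add_var] at hi
      exact hN m' i (cons_zero_injective hi)
  · have := congrFun hi 0
    simp [var] at this
    omega

lemma Down.colon_sec {N : Set (Fin (k + 2) → ℕ)} (h : Down N) {m : Fin (k + 1) → ℕ}
    (hm : m ∈ _root_.colon (_root_.sec N)) : m ∈ _root_.sec (_root_.colon N) := by
  have := h (consZero m) 0 (0 : Fin (k + 1)).succ (Fin.succ_pos _)
  rw [cons_add_var] at this
  exact this hm

/-- Green's hyperplane restriction theorem for complements of strongly stable sets. -/
lemma Down.cnt_sec_le {N : Set (Fin (k + 1) → ℕ)} (hN : Down N) (t : ℕ) :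
    cnt (_root_.sec N) t ≤ green (cnt N t) t := by
  induction k generalizing t with
  | zero =>
    cases t with
    | zero => simp [cnt_zero_eq]
    | succ t => simp [cnt_fin_zero_succ]
  | succ k ihk =>
    induction t generalizing N with
    | zero => simp [cnt_zero_eq]
    | succ t iht =>
      rw [cnt_succ_eq N]
      apply le_green_of_minusMinus_le
      have h1 := ihk hN.sec (t + 1)
      have h2 := cnt_succ_eq (_root_.sec N) t
      have h3 := iht hN.colon
      have h4 : cnt (_root_.colon (_root_.sec N)) t ≤ cnt (_root_.sec (_root_.colon N)) t :=
        cnt_le fun m _ hm => hN.colon_sec hm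
      have h5 := green_add_minusMinus (t + 1) (cnt (_root_.sec N) (t + 1))
      omega

/-- In degrees beyond the generators, membership is not affected by the first variable. -/
lemma mem_colon_iff {N : Set (Fin (k + 1) → ℕ)} {d : ℕ} (h1 : Down N) (h2 : DivClosed N)
    (h3 : GenBy N d) {m : Fin (k + 1) → ℕ} (hm : d ≤ deg m) : m ∈ colon N ↔ m ∈ N := by
  refine ⟨h2 m 0, fun h => h3 _ (by simpa using Nat.lt_succ_of_le hm) fun m' i hi => ?_⟩
  by_cases hi0 : i = 0
  · subst hi0
    rwa [← add_right_cancel hi]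
  · have hpos : 1 ≤ m i := by
      have := congrFun hi i
      simp [var, hi0] at this
      omega
    obtain ⟨m'', rfl⟩ := exists_eq_add_var hpos
    rw [add_right_comm] at hi
    rw [← add_right_cancel hi]
    exact h1 m'' 0 i (Fin.pos_iff_ne_zero.2 hi0) h

end Stable

/-! ## Growth vectors -/

/-- The growth vector of `N` in degree `s + 1`: the numbers of monomials in `N` of degree `s + 1`
with a given minimal variable. -/
noncomputable def growth : (k : ℕ) → Set (Fin k → ℕ) → ℕ → ℕ → ℕ
  | 0, _, _, _ => 0
  | _ + 1, N, s, 0 => cnt (colon N) s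
  | k + 1, N, s, j + 1 => growth k (sec N) s j

lemma growth_succ_le {k : ℕ} {N : Set (Fin k → ℕ)} (hN : Down N) (s j : ℕ) :
    growth k N s (j + 1) ≤ green (growth k N s j) s := by
  induction j generalizing k with
  | zero =>
    match k, N, hN with
    | 0, _, _ => simp [growth]
    | 1, _, _ => simp [growth]
    | k + 2, N, hN =>
      exact (cnt_le fun m _ hm => hN.colon_sec hm).trans (hN.colon.cnt_sec_le s)
  | succ j ih =>
    match k, N, hN with
    | 0, _, _ => simp [growth]
    | k + 1, N, hN => exact ih hN.sec

lemma growth_zero_le {k : ℕ} {N : Set (Fin k → ℕ)} (hN : DivClosed N) (s : ℕ) :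
    growth k N s 0 ≤ cnt N s := by
  match k, N, hN with
  | 0, _, _ => simp [growth]
  | k + 1, N, hN => exact cnt_le fun m _ hm => hN m 0 hm

lemma growth_eq_zero {k : ℕ} (N : Set (Fin k → ℕ)) (s : ℕ) {j : ℕ} (hj : k ≤ j) :
    growth k N s j = 0 := by
  induction k generalizing j with
  | zero => rfl
  | succ k ih =>
    obtain ⟨j, rfl⟩ : ∃ i, j = i + 1 := ⟨j - 1, by omega⟩
    exact ih _ (by omega)

lemma growth_congr {k : ℕ} {N N' : Set (Fin k → ℕ)} {s : ℕ}
    (h : ∀ m, deg m = s + 1 → (m ∈ N ↔ m ∈ N')) (j : ℕ) : growth k N s j = growth k N' s j := by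
  induction k generalizing j with
  | zero => rfl
  | succ k ih =>
    cases j with
    | zero => exact cnt_congr fun m hm => h _ (by simp [hm])
    | succ j => exact ih (fun m hm => h _ (by simp [hm])) j

/-- Beyond the generators, the Hilbert function is determined by the growth vector. -/
lemma cnt_eq_sum_growth {k : ℕ} {N : Set (Fin k → ℕ)} {s : ℕ} (h1 : Down N) (h2 : DivClosed N)
    (h3 : GenBy N (s + 1)) (r : ℕ) :
    cnt N (s + 1 + r) = ∑ j ∈ Finset.range k, (r + j).choose j * growth k N s j := by
  induction k generalizing r with
  | zero => rw [add_right_comm]; simp [cnt_fin_zero_succ]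
  | succ k ih =>
    have key := ih h1.sec h2.sec h3.sec
    induction r with
    | zero =>
      rw [add_zero, cnt_succ_eq, ← add_zero (s + 1), key, Finset.sum_range_succ']
      simp [growth]
    | succ r ihr =>
      rw [← add_assoc, cnt_succ_eq, add_assoc (s + 1), key,
        cnt_congr fun m hm => mem_colon_iff h1 h2 h3 (by omega), ihr, Finset.sum_range_succ',
        Finset.sum_range_succ' _ k, ← add_assoc, ← Finset.sum_add_distrib]
      congr 1
      · refine Finset.sum_congr rfl fun j _ => ?_
        rw [show r + 1 + (j + 1) = (r + 1 + j) + 1 by ring, Nat.choose_succ_succ',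
          show r + (j + 1) = r + 1 + j by ring, add_mul]
        rfl
      · simp

/-! ## Lexicographic sets -/

/-- The `e`-fold iterate of `minusMinus`, starting in base `t`. -/
def iterM : ℕ → ℕ → ℕ → ℕ
  | 0, _, a => a
  | e + 1, t, a => iterM e (t - 1) (minusMinus a t)

/-- An auxiliary value which is positive on the first `a` monomials of degree `t`. -/
def lexVal : (k : ℕ) → ℕ → ℕ → (Fin k → ℕ) → ℕ
  | 0, _, a, _ => a
  | k + 1, t, a, m => lexVal k (t - m 0) (green (iterM (m 0) t a) (t - m 0)) (Fin.tail m)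

/-- In degree `t`, the complement of a lex-segment, consisting of `a` monomials. -/
def LexSet (k t a : ℕ) : Set (Fin k → ℕ) := {m | 1 ≤ lexVal k t a m}

section Lex

variable {k : ℕ}

lemma iterM_mono (e t : ℕ) : Monotone (iterM e t) := by
  induction e generalizing t with
  | zero => exact monotone_id
  | succ e ih => exact fun a b h => ih _ (minusMinus_mono t h)

lemma lexVal_mono (t : ℕ) (m : Fin k → ℕ) : Monotone fun a => lexVal k t a m := by
  induction k generalizing t with
  | zero => exact monotone_id
  | succ k ih => exact fun a b h => ih _ _ (green_mono _ (iterM_mono _ _ h))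

lemma lexSet_mono (k t : ℕ) : Monotone (LexSet k t) :=
  fun _ _ h m hm => le_trans (show 1 ≤ _ from hm) (lexVal_mono t m h)

lemma sec_lexSet (k t a : ℕ) : sec (LexSet (k + 1) t a) = LexSet k t (green a t) := by
  ext m
  simp [sec, LexSet, lexVal, iterM]

lemma colon_lexSet (k t a : ℕ) :
    colon (LexSet (k + 1) (t + 1) a) = LexSet (k + 1) t (minusMinus a (t + 1)) := by
  ext m
  simp [colon, LexSet, lexVal, iterM, tail_add_var_zero]

lemma downAt_lexSet (k t a : ℕ) : DownAt t (LexSet k t a) := by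
  induction k generalizing t a with
  | zero => exact fun m _ i => i.elim0
  | succ k ihk =>
    induction t generalizing a with
    | zero => exact fun m hm => by omega
    | succ t iht =>
      refine downAt_succ ?_ ?_ fun m hm j hj => ?_
      · rw [sec_lexSet]; exact ihk _ _
      · rw [colon_lexSet]; exact iht _
      · rw [colon_lexSet, sec_lexSet]
        rw [sec_lexSet] at hj
        match k, ihk, m, hm, j, hj with
        | k + 1, ihk, m, hm, j, hj =>
          have h0 : m ∈ colon (LexSet (k + 1) (t + 1) (green a (t + 1))) := by
            rcases eq_or_ne j 0 with rfl | h
            · exact hj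
            · exact ihk _ _ m (by omega) 0 j (Fin.pos_iff_ne_zero.2 h) hj
          rw [colon_lexSet] at h0
          exact lexSet_mono _ _ (minusMinus_green_le t a) h0

lemma mem_lexSet_of_add_var {t a b : ℕ} (h : minusMinus b (t + 1) ≤ a) {m : Fin k → ℕ}
    (hm : deg m = t) {i : Fin k} (hi : m + var i ∈ LexSet k (t + 1) b) : m ∈ LexSet k t a := by
  match k, m, hm, i, hi with
  | k + 1, m, hm, i, hi =>
    have h0 : m ∈ colon (LexSet (k + 1) (t + 1) b) := by
      rcases eq_or_ne i 0 with rfl | h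
      · exact hi
      · exact downAt_lexSet _ _ _ m (by omega) 0 i (Fin.pos_iff_ne_zero.2 h) hi
    rw [colon_lexSet] at h0
    exact lexSet_mono _ _ h h0

lemma cnt_lexSet {k t a : ℕ} (h : a ≤ k.multichoose t) : cnt (LexSet k t a) t = a := by
  induction k generalizing t a with
  | zero =>
    cases t with
    | zero =>
      rw [Nat.multichoose_zero_right] at h
      interval_cases a
      · simp [cnt, LexSet, lexVal]
      · exact cnt_fin_zero_zero fun m => by simp [LexSet, lexVal]
    | succ t => simp_all [cnt_fin_zero_succ]
  | succ k ihk =>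
    induction t generalizing a with
    | zero =>
      rw [cnt_zero_eq, sec_lexSet, green_zero_right]
      exact ihk (by simpa using h)
    | succ t iht =>
      rw [cnt_succ_eq, sec_lexSet, colon_lexSet, ihk (green_le_multichoose h),
        iht (minusMinus_le_multichoose h), green_add_minusMinus]

/-- The union over all degrees of lexicographic sets with prescribed cardinalities. -/
def lexUnion (k : ℕ) (h : ℕ → ℕ) : Set (Fin k → ℕ) := {m | m ∈ LexSet k (deg m) (h (deg m))}

lemma down_lexUnion (k : ℕ) (h : ℕ → ℕ) : Down (lexUnion k h) := by
  intro m i j hij hj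
  simp only [lexUnion, Set.mem_ofPred_eq, deg_add, deg_var] at hj ⊢
  exact downAt_lexSet _ _ _ m rfl i j hij hj

lemma divClosed_lexUnion {h : ℕ → ℕ} (hh : ∀ t, minusMinus (h (t + 1)) (t + 1) ≤ h t) :
    DivClosed (lexUnion k h) := by
  intro m i hi
  simp only [lexUnion, Set.mem_ofPred_eq, deg_add, deg_var] at hi ⊢
  exact mem_lexSet_of_add_var (hh _) rfl hi

lemma cnt_lexUnion {h : ℕ → ℕ} (t : ℕ) (hh : h t ≤ k.multichoose t) :
    cnt (lexUnion k h) t = h t := by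
  rw [← cnt_lexSet hh]
  refine cnt_congr fun m hm => ?_
  simp only [lexUnion, Set.mem_ofPred_eq, hm]

end Lex

/-! ## Sets with prescribed growth vector -/

/-- The set of monomials of degree `s + 1` with growth vector `γ` whose growth classes are
complements of lex-segments. -/
noncomputable def glSet : (k : ℕ) → ℕ → (ℕ → ℕ) → Set (Fin k → ℕ)
  | 0, _, _ => ∅
  | k + 1, s, γ => {m | if m 0 = 0 then Fin.tail m ∈ glSet k s fun j => γ (j + 1)
      else m - var 0 ∈ LexSet (k + 1) s (γ 0)}

section GrowthLex

variable {k s : ℕ} {γ : ℕ → ℕ}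

lemma sec_glSet (k s : ℕ) (γ : ℕ → ℕ) :
    sec (glSet (k + 1) s γ) = glSet k s fun j => γ (j + 1) := by
  ext m
  simp [sec, glSet]

lemma colon_glSet (k s : ℕ) (γ : ℕ → ℕ) :
    colon (glSet (k + 1) s γ) = LexSet (k + 1) s (γ 0) := by
  ext m
  simp [colon, glSet]

lemma downAt_glSet (hγ : ∀ j, γ (j + 1) ≤ green (γ j) s) : DownAt (s + 1) (glSet k s γ) := by
  induction k generalizing γ with
  | zero => exact fun m _ i => i.elim0
  | succ k ih =>
    have hd := ih (γ := fun j => γ (j + 1)) fun j => hγ (j + 1)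
    clear ih
    refine downAt_succ ?_ ?_ fun m hm j hj => ?_
    · rw [sec_glSet]; exact hd
    · rw [colon_glSet]; exact downAt_lexSet _ _ _
    · rw [colon_glSet, sec_lexSet]
      rw [sec_glSet] at hj
      match k, hd, m, hm, j, hj with
      | k + 1, hd, m, hm, j, hj =>
        have h0 : m ∈ colon (glSet (k + 1) s fun j => γ (j + 1)) := by
          rcases eq_or_ne j 0 with rfl | h
          · exact hj
          · exact hd m (by omega) 0 j (Fin.pos_iff_ne_zero.2 h) hj
        rw [colon_glSet] at h0
        exact lexSet_mono _ _ (hγ 0) h0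

lemma mem_lexSet_of_add_var_mem_glSet (hγ : ∀ j, γ (j + 1) ≤ green (γ j) s) {m : Fin k → ℕ}
    (hm : deg m = s) {i : Fin k} (hi : m + var i ∈ glSet k s γ) : m ∈ LexSet k s (γ 0) := by
  match k, m, hm, i, hi with
  | k + 1, m, hm, i, hi =>
    rw [← colon_glSet]
    rcases eq_or_ne i 0 with rfl | h
    · exact hi
    · exact downAt_glSet hγ m (by omega) 0 i (Fin.pos_iff_ne_zero.2 h) hi

lemma growth_glSet (hs : 1 ≤ s) (hγ : ∀ j, γ (j + 1) ≤ green (γ j) s)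
    (h0 : γ 0 ≤ k.multichoose s) (j : ℕ) : growth k (glSet k s γ) s j = γ j := by
  obtain ⟨s, rfl⟩ : ∃ i, s = i + 1 := ⟨s - 1, by omega⟩
  induction k generalizing γ j with
  | zero =>
    symm
    induction j with
    | zero => simpa [growth] using h0
    | succ j ih =>
      have := hγ j
      rw [ih] at this
      simpa [growth] using this
  | succ k ih =>
    cases j with
    | zero => rw [growth, colon_glSet, cnt_lexSet h0]
    | succ j =>
      rw [growth, sec_glSet]
      exact ih j (fun j => hγ (j + 1)) ((hγ 0).trans (green_le_multichoose h0))

end GrowthLex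

/-! ## Grafting a growth vector onto a lexicographic set -/

/-- The set which is lexicographic with cardinalities `h` up to degree `s`, and is as large as
possible with growth vector `γ` in degree `s + 1`. -/
def graft (k s : ℕ) (h γ : ℕ → ℕ) : Set (Fin k → ℕ) :=
  {m | (deg m ≤ s → m ∈ LexSet k (deg m) (h (deg m))) ∧
    ∀ d, d ≤ m → deg d = s + 1 → d ∈ glSet k s γ}

section Graft

variable {k s : ℕ} {h γ : ℕ → ℕ}

lemma deg_mono {d m : Fin k → ℕ} (hd : d ≤ m) : deg d ≤ deg m :=
  Finset.sum_le_sum fun i _ => hd i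

lemma le_add_var (m : Fin k → ℕ) (i : Fin k) : m ≤ m + var i := le_self_add

lemma down_graft (hγ : ∀ j, γ (j + 1) ≤ green (γ j) s) : Down (graft k s h γ) := by
  rintro m i j hij ⟨h1, h2⟩
  refine ⟨fun hm => ?_, fun d hd hds => ?_⟩
  · simp only [deg_add, deg_var] at h1 hm ⊢
    exact downAt_lexSet _ _ _ m rfl i j hij (h1 hm)
  · by_cases hi : d i ≤ m i
    · refine h2 d (fun l => ?_) hds
      by_cases hl : l = i
      · subst hl; exact hi.trans (le_add_var m j l)
      · refine (hd l).trans ?_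
        simp [var, hl]
    · obtain ⟨d, rfl⟩ := exists_eq_add_var (m := d) (i := i) (by omega)
      have hdm : d ≤ m := le_of_add_le_add_right hd
      refine downAt_glSet hγ d (by simpa using hds) i j hij (h2 _ ?_ (by simpa using hds))
      exact add_le_add_left hdm _

lemma divClosed_graft (hγ : ∀ j, γ (j + 1) ≤ green (γ j) s)
    (hh : ∀ t, t < s → minusMinus (h (t + 1)) (t + 1) ≤ h t) (h0 : γ 0 ≤ h s) :
    DivClosed (graft k s h γ) := by
  rintro m i ⟨h1, h2⟩
  refine ⟨fun hm => ?_, fun d hd hds => h2 d (hd.trans (le_add_var _ _)) hds⟩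
  rcases hm.lt_or_eq with hm | hm
  · simp only [deg_add, deg_var] at h1
    exact mem_lexSet_of_add_var (hh _ hm) rfl (h1 hm)
  · rw [hm]
    exact lexSet_mono _ _ h0
      (mem_lexSet_of_add_var_mem_glSet hγ hm (h2 _ le_rfl (by simp [hm])))

lemma genBy_graft (k s : ℕ) (h γ : ℕ → ℕ) : GenBy (graft k s h γ) (s + 1) := by
  intro m hm hN
  refine ⟨fun h => by omega, fun d hd hds => ?_⟩
  have hne : ∃ i, d i < m i := by
    by_contra hne
    push Not at hne
    have := deg_mono hne
    omega
  obtain ⟨i, hi⟩ := hne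
  obtain ⟨m, rfl⟩ := exists_eq_add_var (m := m) (i := i) (by omega)
  refine (hN m i rfl).2 d (fun l => ?_) hds
  by_cases hl : l = i
  · subst hl; simp [var] at hi; omega
  · simpa [var, hl] using hd l

lemma cnt_graft {t : ℕ} (ht : t ≤ s) (hh : h t ≤ k.multichoose t) :
    cnt (graft k s h γ) t = h t := by
  refine (cnt_congr fun m hm => ?_).trans (cnt_lexSet hh)
  subst hm
  refine ⟨fun hm => hm.1 ht, fun hm => ⟨fun _ => hm, fun d hd hds => ?_⟩⟩
  have := deg_mono hd
  omega

lemma growth_graft (hs : 1 ≤ s) (hγ : ∀ j, γ (j + 1) ≤ green (γ j) s)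
    (h0 : γ 0 ≤ k.multichoose s) (j : ℕ) : growth k (graft k s h γ) s j = γ j := by
  rw [← growth_glSet hs hγ h0 j]
  refine growth_congr (fun m hm => Iff.intro (fun h => h.2 m le_rfl hm) fun hm' => ?_) j
  refine ⟨fun _ => by omega, fun d hd hds => ?_⟩
  have hdm : d = m := by
    by_contra hne
    obtain ⟨i, hi⟩ := (Pi.lt_def.1 (lt_of_le_of_ne hd hne)).2
    have := Finset.sum_lt_sum (fun i _ => hd i) ⟨i, Finset.mem_univ i, hi⟩
    rw [deg] at hm hds
    omega
  rwa [hdm]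

end Graft

/-! ## Strongly stable ideals -/

section Ideals

variable {n : ℕ}

lemma borelStep_add_var (m : Mon n) {i j : Fin (n + 1)} (h : i ≠ j) :
    borelStep (m + var j) j i = m + var i := by
  funext l
  by_cases hj : l = j
  · subst hj; simp [borelStep, var, h.symm]
  · by_cases hi : l = i
    · subst hi; simp [borelStep, var, hj]
    · simp [borelStep, var, hj, hi]

lemma shrinkAt_add_var (m : Mon n) (i : Fin (n + 1)) : shrinkAt (m + var i) i = m := by
  funext l
  by_cases hi : l = i
  · subst hi; simp [shrinkAt]
  · simp [shrinkAt, var, hi]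

lemma DivClosed.of_add {k : ℕ} {N : Set (Fin k → ℕ)} (hN : DivClosed N) {m m' : Fin k → ℕ}
    (h : m + m' ∈ N) : m ∈ N := by
  induction hd : deg m' generalizing m' with
  | zero =>
    have h0 : m' = 0 := by
      funext i
      exact (Finset.sum_eq_zero_iff.1 hd) i (Finset.mem_univ i)
    simpa [h0] using h
  | succ d ih =>
    have hne : ∃ i, 1 ≤ m' i := by
      by_contra hne
      push Not at hne
      have : deg m' = 0 := Finset.sum_eq_zero fun i _ => by have := hne i; omega
      omega
    obtain ⟨i, hi⟩ := hne
    obtain ⟨m', rfl⟩ := exists_eq_add_var hi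
    rw [← add_assoc] at h
    exact ih (hN _ i h) (by simpa using hd)

/-- The monomial ideal in one more variable whose sections all have complement `C`. -/
def coneIdeal (C : Set (Fin n → ℕ)) : Set (Mon n) := {m | Fin.tail m ∉ C}

lemma tail_add_var_succ (m : Mon n) (i : Fin n) :
    Fin.tail (m + var i.succ) = Fin.tail m + var i := by
  funext l
  by_cases h : l = i <;> simp [Fin.tail, var, h]

variable {C : Set (Fin n → ℕ)}

lemma stronglyStable_coneIdeal (h1 : Down C) (h2 : DivClosed C) :
    StronglyStable (coneIdeal C) := by
  refine ⟨fun m hm m' h => hm (h2.of_add (m' := Fin.tail m') h), fun m hm j i hij hj => ?_⟩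
  obtain ⟨m, rfl⟩ := exists_eq_add_var hj
  rw [borelStep_add_var m hij.ne']
  obtain ⟨i, rfl⟩ := Fin.exists_succ_eq.2 (Fin.ne_zero_of_lt hij)
  have hm' : Fin.tail (m + var j) ∉ C := hm
  change Fin.tail (m + var i.succ) ∉ C
  rw [tail_add_var_succ]
  induction j using Fin.cases with
  | zero =>
    rw [tail_add_var_zero] at hm'
    exact fun h => hm' (h2 _ _ h)
  | succ j =>
    rw [tail_add_var_succ] at hm'
    exact fun h => hm' (h1 _ _ _ (Fin.succ_lt_succ_iff.1 hij) h)

lemma monSat_coneIdeal (C : Set (Fin n → ℕ)) : monSat (coneIdeal C) = coneIdeal C := by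
  ext m
  constructor
  · intro hm
    obtain ⟨k, hk⟩ := hm 0
    have h : Fin.tail (fun l => if l = 0 then m l + k else m l) = Fin.tail m := by
      funext l; simp [Fin.tail, Fin.succ_ne_zero]
    rw [coneIdeal, Set.mem_ofPred_eq, h] at hk
    exact hk
  · exact fun hm i => ⟨0, by simpa using hm⟩

lemma hilb_eq_of_sec {J : Set (Mon n)} (h : colon Jᶜ = Jᶜ) (t : ℕ) :
    hilb J (t + 1) = hilb J t + cnt (sec Jᶜ) (t + 1) := by
  change cnt Jᶜ (t + 1) = cnt Jᶜ t + _
  rw [cnt_succ_eq, h, add_comm]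

lemma hilb_zero_eq (J : Set (Mon n)) : hilb J 0 = cnt (sec Jᶜ) 0 := cnt_zero_eq Jᶜ

lemma sec_coneIdeal (C : Set (Fin n → ℕ)) : sec (coneIdeal C)ᶜ = C := by
  ext m
  simp [sec, coneIdeal]

lemma colon_coneIdeal (C : Set (Fin n → ℕ)) : colon (coneIdeal C)ᶜ = (coneIdeal C)ᶜ := by
  ext m
  simp [colon, coneIdeal, tail_add_var_zero]

lemma monReg_coneIdeal_le {d : ℕ} (h : GenBy C d) : monReg (coneIdeal C) ≤ d := by
  refine csSup_le' ?_
  rintro _ ⟨m, ⟨hm, hmin⟩, rfl⟩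
  by_contra hd
  rcases cons_or_add_var m with ⟨m, rfl⟩ | ⟨m, rfl⟩
  · have hdeg : d < deg m := by
      have : mdeg (consZero m) = deg m := (deg_cons 0 m).trans (zero_add _)
      omega
    refine hm (h m hdeg fun m' i hi => ?_)
    subst hi
    have := hmin i.succ (by simp)
    rw [← cons_add_var, shrinkAt_add_var] at this
    simpa [coneIdeal] using this
  · refine hmin 0 (by simp) ?_
    rw [shrinkAt_add_var]
    simpa [coneIdeal, tail_add_var_zero] using hm

variable {u : ℕ → ℤ}

lemma hilb_coneIdeal (hC : ∀ t, (cnt C t : ℤ) = nderiv u t) (hu : u 0 = 1) (t : ℕ) :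
    (hilb (coneIdeal C) t : ℤ) = u t := by
  induction t with
  | zero => rw [hilb_zero_eq, sec_coneIdeal, hC, hu]; rfl
  | succ t ih =>
    rw [hilb_eq_of_sec (colon_coneIdeal C), sec_coneIdeal, Nat.cast_add, ih, hC]
    simp [nderiv]

lemma mReg_le (h1 : Down C) (h2 : DivClosed C) {d : ℕ} (h3 : GenBy C d)
    (hC : ∀ t, (cnt C t : ℤ) = nderiv u t) (hu : u 0 = 1) : mReg u ≤ d := by
  refine (Nat.sInf_le ?_).trans (monReg_coneIdeal_le h3)
  exact ⟨n, coneIdeal C, stronglyStable_coneIdeal h1 h2, monSat_coneIdeal C,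
    hilb_coneIdeal hC hu, rfl⟩

variable {J : Set (Mon n)}

lemma StronglyStable.down (hJ : StronglyStable J) : Down Jᶜ := by
  intro m i j hij hj hi
  refine hj ?_
  rw [← borelStep_add_var m hij.ne']
  exact hJ.2 _ hi i j hij (by simp)

lemma StronglyStable.divClosed (hJ : StronglyStable J) : DivClosed Jᶜ :=
  fun _ _ hi hm => hi (hJ.1 _ hm _)

lemma StronglyStable.colon_eq (hJ : StronglyStable J) (hsat : monSat J = J) :
    colon Jᶜ = Jᶜ := by
  ext m
  refine ⟨hJ.divClosed m 0, fun hm h0 => hm ?_⟩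
  rw [← hsat]
  intro i
  refine ⟨1, ?_⟩
  have hi : m + var i ∈ J := by
    rcases eq_or_ne i 0 with rfl | hi
    · exact h0
    · by_contra hn
      exact hJ.down m 0 i (Fin.pos_iff_ne_zero.2 hi) hn h0
  convert hi using 1
  funext l
  by_cases hl : l = i
  · subst hl; simp
  · simp [var, hl]

lemma bddAbove_minGen_deg (hJ : MonIdeal J) :
    BddAbove {d | ∃ m : Mon n, IsMinGen J m ∧ mdeg m = d} := by
  have hanti : IsAntichain (· ≤ ·) {m | IsMinGen J m} := by
    intro a ha b hb hne hab
    obtain ⟨i, hi⟩ := (Pi.lt_def.1 (lt_of_le_of_ne hab hne)).2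
    obtain ⟨b, rfl⟩ := exists_eq_add_var (m := b) (i := i) (by omega)
    refine hb.2 i (by simp) ?_
    rw [shrinkAt_add_var]
    have hab' : a ≤ b := by
      intro l
      by_cases hl : l = i
      · subst hl; simp at hi; omega
      · simpa [var, hl] using hab l
    obtain ⟨c, rfl⟩ := exists_add_of_le hab'
    exact hJ a ha.1 c
  exact ((WellQuasiOrderedLE.finite_of_isAntichain hanti).image mdeg).bddAbove

lemma StronglyStable.genBy_sec (hJ : StronglyStable J) : GenBy (sec Jᶜ) (monReg J) := by
  intro m hm hN hmJ
  refine hm.not_ge (le_csSup (bddAbove_minGen_deg hJ.1) ⟨consZero m, ⟨hmJ, fun i hi => ?_⟩, ?_⟩)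
  · induction i using Fin.cases with
    | zero => simp at hi
    | succ i =>
      obtain ⟨m, rfl⟩ := exists_eq_add_var (m := m) (i := i) (by simpa using hi)
      rw [← cons_add_var, shrinkAt_add_var]
      exact hN m i rfl
  · exact (deg_cons 0 m).trans (zero_add _)

end Ideals

section Existence

variable {u : ℕ → ℤ}

lemma OSeq.toNat_le_multichoose (h : OSeq u) (t : ℕ) :
    (u t).toNat ≤ ((u 1).toNat + 1).multichoose t := by
  induction t with
  | zero => simp [h.2.1]
  | succ t ih =>
    cases t with
    | zero => simp
    | succ t =>
      rw [← plusPlus_multichoose]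
      refine le_trans ?_ (plusPlus_mono (by omega) ih)
      have := h.2.2 (t + 1) (by omega)
      simp only
      omega

lemma OSeq.minusMinus_le (h : OSeq u) (t : ℕ) :
    minusMinus (u (t + 1)).toNat (t + 1) ≤ (u t).toNat := by
  cases t with
  | zero =>
    rw [h.2.1]
    rcases Nat.eq_zero_or_pos (u 1).toNat with h0 | h0
    · simp [h0]
    · simp [minusMinus_one h0]
  | succ t =>
    rw [minusMinus_le_iff (Or.inl (by omega))]
    have := h.2.2 (t + 1) (by omega)
    omega

lemma exists_of_mReg (hu : u 0 = 1) (h : OSeq (nderiv u)) :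
    ∃ (k : ℕ) (C : Set (Fin k → ℕ)), Down C ∧ DivClosed C ∧ GenBy C (mReg u) ∧
      ∀ t, (cnt C t : ℤ) = nderiv u t := by
  have hne : {r | ∃ (n : ℕ) (J : Set (Mon n)), StronglyStable J ∧ monSat J = J ∧
      (∀ t : ℕ, (hilb J t : ℤ) = u t) ∧ monReg J = r}.Nonempty := by
    set k := (nderiv u 1).toNat + 1
    set C := lexUnion k fun t => (nderiv u t).toNat
    have hC : ∀ t, (cnt C t : ℤ) = nderiv u t := fun t => by
      rw [cnt_lexUnion t (h.toNat_le_multichoose t), Int.toNat_of_nonneg (h.1 t)]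
    exact ⟨_, k, coneIdeal C, stronglyStable_coneIdeal (down_lexUnion _ _)
      (divClosed_lexUnion h.minusMinus_le), monSat_coneIdeal C, hilb_coneIdeal hC hu, rfl⟩
  obtain ⟨n, J, hJ, hsat, hH, hr⟩ := Nat.sInf_mem hne
  refine ⟨n, sec Jᶜ, hJ.down.sec, hJ.divClosed.sec, ?_, fun t => ?_⟩
  · rw [mReg, ← hr]; exact hJ.genBy_sec
  · cases t with
    | zero => rw [← hilb_zero_eq, hH, hu]; rfl
    | succ t =>
      rw [nderiv, ← hH, ← hH, hilb_eq_of_sec (hJ.colon_eq hsat)]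
      push_cast; ring

lemma GenBy.mono {k : ℕ} {N : Set (Fin k → ℕ)} {d e : ℕ} (h : GenBy N d) (hde : d ≤ e) :
    GenBy N e :=
  fun m hm hN => h m (hde.trans_lt hm) hN

lemma cnt_eq_sum_growth_of_le {k : ℕ} {N : Set (Fin k → ℕ)} {s : ℕ} (h1 : Down N)
    (h2 : DivClosed N) (h3 : GenBy N (s + 1)) (r : ℕ) {l : ℕ} (hl : k ≤ l) :
    cnt N (s + 1 + r) = ∑ j ∈ Finset.range l, (r + j).choose j * growth k N s j := by
  rw [cnt_eq_sum_growth h1 h2 h3]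
  refine Finset.sum_subset (Finset.range_subset_range.2 hl) fun j _ hj => ?_
  rw [growth_eq_zero N s (by simpa using hj), mul_zero]

/-- The derivative of a Hilbert function may be enlarged in degrees at most `s` without
increasing the minimal regularity beyond `s + 1`. -/
lemma mReg_le_of_eqOn {q w : ℕ → ℤ} (hq0 : q 0 = 1) (hq : OSeq (nderiv q)) (hw0 : w 0 = 1)
    (hw : OSeq (nderiv w)) {s : ℕ} (hs : 1 ≤ s) (hm : mReg q ≤ s + 1)
    (h1 : ∀ t, s + 1 ≤ t → nderiv w t = nderiv q t) (h2 : nderiv q s ≤ nderiv w s) :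
    mReg w ≤ s + 1 := by
  obtain ⟨kq, C, hC1, hC2, hC3, hC4⟩ := exists_of_mReg hq0 hq
  replace hC3 := hC3.mono hm
  set γ : ℕ → ℕ := growth kq C s
  set h : ℕ → ℕ := fun t => (nderiv w t).toNat
  set k := (nderiv w 1).toNat + 1
  have hγ : ∀ j, γ (j + 1) ≤ green (γ j) s := fun j => growth_succ_le hC1 s j
  have hγ0 : γ 0 ≤ h s := by
    have h3 : γ 0 ≤ cnt C s := growth_zero_le hC2 s
    have := hC4 s
    simp only [h]
    omega
  have hh : ∀ t, h t ≤ k.multichoose t := hw.toNat_le_multichoose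
  have hd : DivClosed (graft k s h γ) :=
    divClosed_graft hγ (fun t _ => hw.minusMinus_le t) hγ0
  refine mReg_le (down_graft hγ) hd (genBy_graft k s h γ) (fun t => ?_) hw0
  rcases le_or_gt t s with ht | ht
  · rw [cnt_graft ht (hh t), Int.toNat_of_nonneg (hw.1 t)]
  · obtain ⟨r, rfl⟩ := Nat.exists_eq_add_of_le (Nat.succ_le_of_lt ht)
    rw [h1 _ (by omega), ← hC4, Nat.cast_inj,
      cnt_eq_sum_growth_of_le (down_graft hγ) hd (genBy_graft k s h γ) r (le_max_left k kq),
      cnt_eq_sum_growth_of_le hC1 hC2 hC3 r (le_max_right k kq)]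
    simp only [growth_graft hs hγ (hγ0.trans (hh s)), γ]

end Existence

/-! ## Polynomial functions -/

/-- `f` has vanishing `k`-th finite difference. -/
def PolyFunLT : ℕ → (ℕ → ℤ) → Prop
  | 0, f => ∀ t, f t = 0
  | k + 1, f => PolyFunLT k fun t => f (t + 1) - f t

/-- `f` is a polynomial function. -/
def PolyFun (f : ℕ → ℤ) : Prop := ∃ k, PolyFunLT k f

section Poly

variable {f g : ℕ → ℤ} {k : ℕ}

lemma PolyFunLT.succ (h : PolyFunLT k f) : PolyFunLT (k + 1) f := by
  induction k generalizing f with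
  | zero =>
    have h' : ∀ t, f t = 0 := h
    intro t
    simp [h']
  | succ k ih => exact ih h

lemma PolyFunLT.mono (h : PolyFunLT k f) {l : ℕ} (hl : k ≤ l) : PolyFunLT l f := by
  induction l, hl using Nat.le_induction with
  | base => exact h
  | succ l _ ih => exact ih.succ

lemma PolyFunLT.add_mul (hf : PolyFunLT k f) (hg : PolyFunLT k g) (c : ℤ) :
    PolyFunLT k fun t => f t + c * g t := by
  induction k generalizing f g with
  | zero =>
    intro t
    simp [show f t = 0 from hf t, show g t = 0 from hg t]
  | succ k ih =>
    have h : (fun t => (f (t + 1) + c * g (t + 1)) - (f t + c * g t)) =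
        fun t => (f (t + 1) - f t) + c * (g (t + 1) - g t) := by
      funext t; ring
    change PolyFunLT k fun t => (f (t + 1) + c * g (t + 1)) - (f t + c * g t)
    rw [h]
    exact ih hf hg

lemma PolyFunLT.eq_zero (hf : PolyFunLT k f) {N : ℕ} (h : ∀ t, N ≤ t → f t = 0) (t : ℕ) :
    f t = 0 := by
  induction k generalizing f t with
  | zero => exact hf t
  | succ k ih =>
    have hd := ih hf fun t ht => by rw [h t ht, h _ (by omega), sub_zero]
    have hc : ∀ t, f t = f 0 := by
      intro t
      induction t with
      | zero => rfl
      | succ t iht => rw [← iht, ← sub_eq_zero, hd]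
    rw [hc, ← hc N, h N le_rfl]

lemma PolyFun.add_mul (hf : PolyFun f) (hg : PolyFun g) (c : ℤ) :
    PolyFun fun t => f t + c * g t := by
  obtain ⟨k, hk⟩ := hf
  obtain ⟨l, hl⟩ := hg
  exact ⟨max k l, (hk.mono (le_max_left _ _)).add_mul (hl.mono (le_max_right _ _)) c⟩

lemma PolyFun.zero : PolyFun fun _ => 0 := ⟨0, fun _ => rfl⟩

lemma PolyFun.sum {F : ℕ → ℕ → ℤ} (c : ℕ → ℤ) (h : ∀ i, PolyFun (F i)) (n : ℕ) :
    PolyFun fun t => ∑ i ∈ Finset.range n, c i * F i t := by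
  induction n with
  | zero => simpa using PolyFun.zero
  | succ n ih => simpa only [Finset.sum_range_succ] using ih.add_mul (h n) (c n)

lemma PolyFun.of_diff (h : PolyFun fun t => f (t + 1) - f t) : PolyFun f :=
  h.imp' Nat.succ fun _ hk => hk

lemma PolyFun.eq_zero (hf : PolyFun f) {N : ℕ} (h : ∀ t, N ≤ t → f t = 0) (t : ℕ) : f t = 0 :=
  hf.elim fun _ hk => hk.eq_zero h t

lemma zchoose_zero (a : ℤ) : zchoose a 0 = 1 := by simp [zchoose]

lemma zchoose_natCast (a k : ℕ) : zchoose a k = a.choose k := by simp [zchoose]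

lemma zchoose_add_one (a : ℤ) (k : ℕ) :
    zchoose (a + 1) (k + 1) = zchoose a k + zchoose a (k + 1) := by
  rcases le_or_gt 0 a with ha | ha
  · lift a to ℕ using ha
    rw [← Nat.cast_add_one]
    simp only [zchoose_natCast, Nat.choose_succ_succ']
    push_cast; ring
  · obtain ⟨n, rfl⟩ : ∃ n : ℕ, a = -(n + 1 : ℤ) := ⟨(-a - 1).toNat, by omega⟩
    have h1 : ((k : ℤ) - 1 - -(n + 1 : ℤ)).toNat = k + n := by omega
    have h2 : (((k + 1 : ℕ) : ℤ) - 1 - -(n + 1 : ℤ)).toNat = k + n + 1 := by omega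
    have h3 : ¬ (0 : ℤ) ≤ -(n + 1 : ℤ) := by omega
    rw [zchoose, zchoose, zchoose, if_neg h3, if_neg h3, h1, h2]
    cases n with
    | zero => simp [pow_succ]
    | succ n =>
      rw [if_neg (by omega), show (((k + 1 : ℕ) : ℤ) - 1 -
        (-((n + 1 : ℕ) + 1 : ℤ) + 1)).toNat = k + (n + 1) by omega, Nat.choose_succ_succ']
      push_cast; ring

lemma polyFun_zchoose (c : ℤ) (k : ℕ) : PolyFun fun t => zchoose (t + c) k := by
  induction k with
  | zero =>
    refine PolyFun.of_diff ?_
    simpa [zchoose_zero] using PolyFun.zero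
  | succ k ih =>
    refine PolyFun.of_diff ?_
    convert ih using 2 with t
    rw [Nat.cast_succ, add_right_comm, zchoose_add_one]
    ring

lemma polyFun_choose (j : ℕ) : PolyFun fun t => ((t + j).choose j : ℤ) := by
  convert polyFun_zchoose j j using 2 with t
  rw [← Nat.cast_add, zchoose_natCast]

lemma GotzmannPoly.polyFun_eval (p : GotzmannPoly) (c : ℤ) : PolyFun fun t => p.eval (t + c) := by
  convert PolyFun.sum (fun _ => 1)
    (fun i => polyFun_zchoose (c + (p.ks.getD i 0 : ℤ) - i) (p.ks.getD i 0)) p.r using 2 with t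
  rw [GotzmannPoly.eval]
  refine Finset.sum_congr rfl fun i _ => ?_
  rw [one_mul]
  congr 1
  ring

end Poly

/-! ## Regularity and minimal functions -/

section Regularity

variable {p : GotzmannPoly} {ρ : ℕ} {w : ℕ → ℤ}

lemma nderiv_of_pos (u : ℕ → ℤ) {t : ℕ} (ht : 1 ≤ t) : nderiv u t = u t - u (t - 1) := by
  obtain ⟨t, rfl⟩ : ∃ i, t = i + 1 := ⟨t - 1, by omega⟩
  rfl

/-- A saturated ideal has a Hilbert function which agrees with the Hilbert polynomial
from one less than the regularity on. -/
lemma eq_eval_of_mReg_le (hw : w ∈ Fset p ρ) {s : ℕ} (hs : mReg w ≤ s + 1) (t : ℕ) (ht : s ≤ t) :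
    w t = p.eval t := by
  obtain ⟨k, C, h1, h2, h3, h4⟩ := exists_of_mReg hw.1.2.1 hw.2.1
  replace h3 := h3.mono hs
  have hw' : PolyFun fun r => w (r + s) := by
    refine PolyFun.of_diff ?_
    convert PolyFun.sum (fun j => (growth k C s j : ℤ)) polyFun_choose k using 2 with r
    have := h4 (s + 1 + r)
    rw [cnt_eq_sum_growth h1 h2 h3, nderiv_of_pos _ (by omega), show s + 1 + r = r + 1 + s by ring,
      show r + 1 + s - 1 = r + s by omega] at this
    rw [← this]
    push_cast
    exact Finset.sum_congr rfl fun _ _ => mul_comm _ _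
  have h0 := (hw'.add_mul (p.polyFun_eval s) (-1)).eq_zero (N := ρ) (fun r hr => by
    rw [hw.2.2.1 _ (by omega)]; push_cast; ring) (t - s)
  rw [Nat.sub_add_cancel ht, Nat.cast_sub ht, sub_add_cancel] at h0
  linarith

lemma lt_mReg (hw : w ∈ Fset p ρ) (hρ : 1 ≤ ρ) : ρ + 1 ≤ mReg w := by
  by_contra h
  have := hw.2.2.2 (ρ - 1) (eq_eval_of_mReg_le hw (by omega))
  omega

lemma Fset.nderiv_eq {ρ' : ℕ} {q : ℕ → ℤ} (hw : w ∈ Fset p ρ) (hq : q ∈ Fset p ρ') {t : ℕ}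
    (h1 : ρ + 1 ≤ t) (h2 : ρ' + 1 ≤ t) : nderiv w t = nderiv q t := by
  rw [nderiv_of_pos _ (by omega), nderiv_of_pos _ (by omega), hw.2.2.1 _ (by omega),
    hw.2.2.1 _ (by omega), hq.2.2.1 _ (by omega), hq.2.2.1 _ (by omega)]

end Regularity

section Fill

variable {f w : ℕ → ℤ} {σ : ℕ}

lemma one_le_minusMinus {a t : ℕ} (ha : 1 ≤ a) : 1 ≤ minusMinus a (t + 1) := by
  rcases Nat.eq_zero_or_pos t with rfl | ht
  · exact (minusMinus_one ha).ge
  · by_contra h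
    have := le_plusPlus_minusMinus ht a
    rw [Nat.lt_one_iff.1 (not_le.1 h), plusPlus_zero_left] at this
    omega

lemma one_le_of_fill (hf : ∀ t < σ, f t = minusMinus (f (t + 1)).toNat (t + 1)) (h1 : 1 ≤ f σ)
    {t : ℕ} (ht : t ≤ σ) : 1 ≤ f t := by
  induction ht using Nat.decreasingInduction with
  | self => exact h1
  | of_succ t ht ih =>
    rw [hf t ht]
    exact_mod_cast one_le_minusMinus (by omega)

lemma le_of_fill (hf : ∀ t < σ, f t = minusMinus (f (t + 1)).toNat (t + 1)) (hw : OSeq w)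
    (h1 : f σ ≤ w σ) {t : ℕ} (ht : t ≤ σ) : f t ≤ w t := by
  induction ht using Nat.decreasingInduction with
  | self => exact h1
  | of_succ t ht ih =>
    rw [hf t ht]
    have h2 := hw.minusMinus_le t
    have h3 : minusMinus (f (t + 1)).toNat (t + 1) ≤ minusMinus (w (t + 1)).toNat (t + 1) :=
      minusMinus_mono _ (Int.toNat_le_toNat ih)
    have := hw.1 t
    omega

lemma eq_one_of_fill (hf : ∀ t < σ, f t = minusMinus (f (t + 1)).toNat (t + 1)) (h1 : 1 ≤ f σ)
    (hσ : 1 ≤ σ) : f 0 = 1 := by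
  have := one_le_of_fill hf h1 hσ
  rw [hf 0 hσ, minusMinus_one (by simp only [zero_add]; omega)]
  rfl

lemma nderiv_of_fill (hf : ∀ t < σ, f t = minusMinus (f (t + 1)).toNat (t + 1)) (h1 : 1 ≤ f σ)
    {t : ℕ} (ht : t < σ) : nderiv f (t + 1) = green (f (t + 1)).toNat (t + 1) := by
  have h2 := green_add_minusMinus (t + 1) (f (t + 1)).toNat
  have h3 := one_le_of_fill hf h1 (Nat.succ_le_of_lt ht)
  rw [nderiv, hf t ht]
  simp only [Nat.succ_eq_add_one] at h3
  omega

lemma nderiv_le_of_fill (hf : ∀ t < σ, f t = minusMinus (f (t + 1)).toNat (t + 1))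
    (h1 : 1 ≤ f σ) {t : ℕ} (ht1 : 1 ≤ t) (ht : t < σ) :
    nderiv f (t + 1) ≤ plusPlus (nderiv f t).toNat t := by
  rw [nderiv_of_fill hf h1 ht]
  obtain ⟨t, rfl⟩ : ∃ i, t = i + 1 := ⟨t - 1, by omega⟩
  rw [nderiv_of_fill hf h1 (by omega), hf (t + 1) ht]
  exact_mod_cast green_le_plusPlus_green (by omega) _

/-- Filling up a function minimally below `σ` preserves admissibility. -/
lemma oSeq_of_fill (hw : OSeq w) (hσ : 1 ≤ σ)
    (hf : ∀ t < σ, f t = minusMinus (f (t + 1)).toNat (t + 1)) (hfw : ∀ t, σ < t → f t = w t)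
    (h1 : 1 ≤ f σ) (hd : f (σ + 1) ≤ plusPlus (f σ).toNat σ) : OSeq f := by
  refine ⟨fun t => ?_, eq_one_of_fill hf h1 hσ, fun t ht => ?_⟩
  · rcases le_or_gt t σ with ht | ht
    · exact zero_le_one.trans (one_le_of_fill hf h1 ht)
    · rw [hfw t ht]; exact hw.1 t
  · rcases lt_trichotomy t σ with h | rfl | h
    · have := le_plusPlus_minusMinus ht (f (t + 1)).toNat
      rw [hf t h, Int.toNat_natCast]
      omega
    · exact hd
    · rw [hfw t h, hfw _ (by omega)]
      exact hw.2.2 t ht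

/-- Filling up a function minimally below `σ` preserves admissibility of the derivative. -/
lemma oSeq_nderiv_of_fill (hw : OSeq (nderiv w))
    (hf : ∀ t < σ, f t = minusMinus (f (t + 1)).toNat (t + 1)) (hfw : ∀ t, σ < t → f t = w t)
    (h1 : 1 ≤ f σ) (h2 : f σ ≤ w σ)
    (hc : nderiv f (σ + 1) ≤ plusPlus (nderiv f σ).toNat σ) : OSeq (nderiv f) := by
  have hge : nderiv w (σ + 1) ≤ nderiv f (σ + 1) := by
    rw [nderiv, nderiv, hfw _ (Nat.lt_add_one σ)]
    omega
  have heq : ∀ t, σ + 2 ≤ t → nderiv f t = nderiv w t := fun t ht => by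
    rw [nderiv_of_pos _ (by omega), nderiv_of_pos _ (by omega), hfw _ (by omega),
      hfw _ (by omega)]
  refine ⟨fun t => ?_, rfl, fun t ht => ?_⟩
  · rcases Nat.eq_zero_or_pos t with rfl | ht0
    · exact zero_le_one
    rcases lt_trichotomy t (σ + 1) with h | rfl | h
    · obtain ⟨t, rfl⟩ : ∃ i, t = i + 1 := ⟨t - 1, by omega⟩
      rw [nderiv_of_fill hf h1 (by omega)]
      exact Int.natCast_nonneg _
    · exact (hw.1 _).trans hge
    · rw [heq t h]; exact hw.1 t
  · rcases lt_trichotomy t σ with h | rfl | h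
    · exact nderiv_le_of_fill hf h1 ht h
    · exact hc
    · rw [heq (t + 1) (by omega)]
      refine (hw.2.2 t ht).trans ?_
      rcases (Nat.succ_le_of_lt h).eq_or_lt with rfl | h
      · exact_mod_cast plusPlus_mono ht (Int.toNat_le_toNat hge)
      · rw [heq t h]

end Fill

section Minimal

variable {p : GotzmannPoly} {ρ : ℕ} {w : ℕ → ℤ}

lemma OSeq.one_le (hw : OSeq w) (hd : OSeq (nderiv w)) (t : ℕ) : 1 ≤ w t := by
  induction t with
  | zero => exact hw.2.1.ge
  | succ t ih =>
    have h : 0 ≤ w (t + 1) - w t := hd.1 (t + 1)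
    omega

lemma mReg_le_of_succ_le {ρ' : ℕ} {q : ℕ → ℤ} (hw : w ∈ Fset p ρ) (hq : q ∈ Fset p ρ') {s : ℕ}
    (h1 : ρ + 1 ≤ s) (h2 : ρ' + 1 ≤ s) (hs : mReg q ≤ s + 1) : mReg w ≤ s + 1 :=
  mReg_le_of_eqOn hq.1.2.1 hq.2.1 hw.1.2.1 hw.2.1 (by omega) hs
    (fun _ ht => Fset.nderiv_eq hw hq (by omega) (by omega)) (Fset.nderiv_eq hw hq h1 h2).ge

lemma mReg_le_of_le {v : ℕ → ℤ} (hw : w ∈ Fset p ρ) (hρ : 1 ≤ ρ) (hv0 : v 0 = 1)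
    (hv : OSeq (nderiv v)) (hvp : ∀ t, ρ ≤ t → v t = p.eval t) (h : v (ρ - 1) ≤ w (ρ - 1)) :
    mReg v ≤ mReg w := by
  have hlt := lt_mReg hw hρ
  obtain ⟨s, hs⟩ : ∃ s, mReg w = s + 1 := ⟨mReg w - 1, by omega⟩
  rw [hs]
  refine mReg_le_of_eqOn hw.1.2.1 hw.2.1 hv0 hv (by omega) hs.le (fun t ht => ?_) ?_
  · rw [nderiv_of_pos _ (by omega), nderiv_of_pos _ (by omega), hw.2.2.1 _ (by omega),
      hw.2.2.1 _ (by omega), hvp _ (by omega), hvp _ (by omega)]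
  · rw [nderiv_of_pos _ (by omega), nderiv_of_pos _ (by omega), hw.2.2.1 _ (by omega),
      hvp _ (by omega)]
    rcases eq_or_ne s ρ with rfl | hne
    · omega
    · rw [hw.2.2.1 _ (by omega), hvp _ (by omega)]

lemma Fset.eq_of_zero {q : ℕ → ℤ} (hw : w ∈ Fset p 0) (hq : q ∈ Fset p 0) : q = w :=
  funext fun t => (hq.2.2.1 t (Nat.zero_le t)).trans (hw.2.2.1 t (Nat.zero_le t)).symm

lemma mReg_lt_iff {q : ℕ → ℤ} (hw : w ∈ Fset p ρ) (hq : q ∈ Fset p ρ) :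
    mReg q < mReg w ↔ mReg q = ρ + 1 ∧ mReg w = ρ + 2 ∧ q (ρ - 1) < w (ρ - 1) := by
  refine ⟨fun h => ?_, fun h => by omega⟩
  rcases Nat.eq_zero_or_pos ρ with rfl | hρ
  · rw [Fset.eq_of_zero hw hq] at h
    omega
  have h1 : mReg q = ρ + 1 := by
    by_contra hne
    have := lt_mReg hq hρ
    have := mReg_le_of_succ_le hw hq (s := mReg q - 1) (by omega) (by omega) (by omega)
    omega
  have h2 := mReg_le_of_succ_le hw hq le_rfl le_rfl (by omega)
  refine ⟨h1, by omega, ?_⟩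
  by_contra h3
  have := mReg_le_of_le hq hρ hw.1.2.1 hw.2.1 hw.2.2.1 (not_lt.1 h3)
  omega

lemma mset_eq (hw : w ∈ Fset p ρ) : (∃ a, Mset p ρ = {a}) ∨ Mset p ρ = {ρ + 1, ρ + 2} := by
  by_cases h : ∃ q ∈ Fset p ρ, mReg q ≠ mReg w
  · right
    have key : ∀ q ∈ Fset p ρ, ∀ u ∈ Fset p ρ, mReg q < mReg u → Mset p ρ = {ρ + 1, ρ + 2} := by
      intro q hq u hu hlt
      obtain ⟨h1, h2, -⟩ := (mReg_lt_iff hu hq).1 hlt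
      refine Set.Subset.antisymm ?_ ?_
      · rintro _ ⟨v, hv, rfl⟩
        rcases lt_trichotomy (mReg v) (mReg u) with hv' | hv' | hv'
        · exact Or.inl ((mReg_lt_iff hu hv).1 hv').1
        · exact Or.inr (hv'.trans h2)
        · have := ((mReg_lt_iff hv hu).1 hv').1
          omega
      · rintro _ (rfl | rfl)
        · exact ⟨q, hq, h1⟩
        · exact ⟨u, hu, h2⟩
    obtain ⟨q, hq, hne⟩ := h
    rcases hne.lt_or_gt with h | h
    · exact key q hq w hw h
    · exact key w hw q hq h
  · left
    push Not at h
    refine ⟨mReg w, Set.Subset.antisymm ?_ ?_⟩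
    · rintro _ ⟨q, hq, rfl⟩
      exact h q hq
    · rintro _ rfl
      exact ⟨w, hw, rfl⟩

lemma fmin_of_le {t : ℕ} (h : ρ ≤ t) : fmin p ρ t = p.eval t := by
  rw [fmin, dif_pos h]

lemma fmin_of_lt {t : ℕ} (h : t < ρ) :
    fmin p ρ t = minusMinus (fmin p ρ (t + 1)).toNat (t + 1) := by
  rw [fmin, dif_neg (by omega)]

lemma gmin_of_le {t : ℕ} (h : ρ ≤ t) : gmin p ρ t = p.eval t := by
  rw [gmin, dif_pos h]

lemma gmin_pred (h : 1 ≤ ρ) : gmin p ρ (ρ - 1) = p.eval ((ρ - 1 : ℕ) : ℤ) + 1 := by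
  rw [gmin, dif_neg (by omega), if_pos rfl]

lemma gmin_of_lt {t : ℕ} (h : t < ρ - 1) :
    gmin p ρ t = minusMinus (gmin p ρ (t + 1)).toNat (t + 1) := by
  rw [gmin, dif_neg (by omega), if_neg h.ne]

lemma fmin_self_eq (hw : w ∈ Fset p ρ) : fmin p ρ ρ = w ρ := by
  rw [fmin_of_le le_rfl, hw.2.2.1 _ le_rfl]

lemma fmin_le (hw : w ∈ Fset p ρ) {t : ℕ} (ht : t ≤ ρ) : fmin p ρ t ≤ w t :=
  le_of_fill (fun _ => fmin_of_lt) hw.1 (fmin_self_eq hw).le ht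

lemma one_le_fmin (hw : w ∈ Fset p ρ) : 1 ≤ fmin p ρ ρ :=
  fmin_self_eq hw ▸ hw.1.one_le hw.2.1 ρ

lemma fmin_eq_of_lt (hw : w ∈ Fset p ρ) {t : ℕ} (ht : ρ < t) : fmin p ρ t = w t := by
  rw [fmin_of_le ht.le, hw.2.2.1 _ ht.le]

lemma oSeq_fmin (hw : w ∈ Fset p ρ) (hρ : 1 ≤ ρ) : OSeq (fmin p ρ) := by
  refine oSeq_of_fill hw.1 hρ (fun _ => fmin_of_lt) (fun _ => fmin_eq_of_lt hw) (one_le_fmin hw) ?_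
  rw [fmin_self_eq hw, fmin_eq_of_lt hw (Nat.lt_add_one ρ)]
  exact hw.1.2.2 ρ hρ

lemma oSeq_nderiv_fmin (hw : w ∈ Fset p ρ) (hρ : 1 ≤ ρ) : OSeq (nderiv (fmin p ρ)) := by
  refine oSeq_nderiv_of_fill hw.2.1 (fun _ => fmin_of_lt) (fun _ => fmin_eq_of_lt hw)
    (one_le_fmin hw) (fmin_self_eq hw).le ?_
  have h1 : nderiv (fmin p ρ) (ρ + 1) = nderiv w (ρ + 1) := by
    rw [nderiv, nderiv, fmin_self_eq hw, fmin_eq_of_lt hw (Nat.lt_add_one ρ)]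
  have h2 : nderiv w ρ ≤ nderiv (fmin p ρ) ρ := by
    rw [nderiv_of_pos _ hρ, nderiv_of_pos _ hρ, fmin_self_eq hw]
    have := fmin_le hw (Nat.sub_le ρ 1)
    omega
  rw [h1]
  exact (hw.2.1.2.2 ρ hρ).trans (mod_cast plusPlus_mono hρ (Int.toNat_le_toNat h2))

lemma mReg_fmin_le (hw : w ∈ Fset p ρ) : mReg (fmin p ρ) ≤ mReg w := by
  rcases Nat.eq_zero_or_pos ρ with rfl | hρ
  · rw [show fmin p 0 = w from funext fun t => by
      rw [fmin_of_le (Nat.zero_le t), hw.2.2.1 t (Nat.zero_le t)]]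
  · exact mReg_le_of_le hw hρ (oSeq_fmin hw hρ).2.1 (oSeq_nderiv_fmin hw hρ)
      (fun _ => fmin_of_le) (fmin_le hw (Nat.sub_le ρ 1))

lemma Fset.ne_eval_pred (hw : w ∈ Fset p ρ) (hρ : 1 ≤ ρ) :
    w (ρ - 1) ≠ p.eval ((ρ - 1 : ℕ) : ℤ) := by
  intro h
  have := hw.2.2.2 (ρ - 1) fun t ht => by
    rcases ht.eq_or_lt with rfl | ht
    · exact h
    · exact hw.2.2.1 t (by omega)
  omega

/-- If `fmin p ρ` has smaller regularity, then `ρ ≥ 2` and `fmin p ρ` agrees with `p`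
at `ρ - 1`. -/
lemma fmin_pred_of_not_isRegOf (hw : w ∈ Fset p ρ) (h : ¬ IsRegOf p (fmin p ρ) ρ) :
    2 ≤ ρ ∧ fmin p ρ (ρ - 1) = p.eval ((ρ - 1 : ℕ) : ℤ) := by
  have h1 : ∃ ρ', (∀ t : ℕ, ρ' ≤ t → fmin p ρ t = p.eval t) ∧ ρ' < ρ := by
    by_contra hne
    push Not at hne
    exact h ⟨fun _ => fmin_of_le, hne⟩
  obtain ⟨ρ', h2, h3⟩ := h1
  have h4 := h2 (ρ - 1) (by omega)
  refine ⟨?_, h4⟩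
  by_contra h5
  obtain rfl : ρ = 1 := by omega
  refine Fset.ne_eval_pred hw le_rfl ?_
  rw [← h4, (oSeq_fmin hw le_rfl).2.1, hw.1.2.1]

lemma eval_pred_lt (hw : w ∈ Fset p ρ) (h : ¬ IsRegOf p (fmin p ρ) ρ) :
    p.eval ((ρ - 1 : ℕ) : ℤ) + 1 ≤ w (ρ - 1) := by
  obtain ⟨h1, h2⟩ := fmin_pred_of_not_isRegOf hw h
  have h3 := Fset.ne_eval_pred hw (by omega)
  have h4 := fmin_le hw (Nat.sub_le ρ 1)
  omega

lemma gmin_mem_fset (hw : w ∈ Fset p ρ) (h : ¬ IsRegOf p (fmin p ρ) ρ) :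
    gmin p ρ ∈ Fset p ρ := by
  obtain ⟨h1, h2⟩ := fmin_pred_of_not_isRegOf hw h
  obtain ⟨σ, rfl⟩ : ∃ i, ρ = i + 1 := ⟨ρ - 1, by omega⟩
  have hσ : 1 ≤ σ := by omega
  have hle := eval_pred_lt hw h
  have hf := oSeq_fmin hw (by omega)
  have hf' := oSeq_nderiv_fmin hw (by omega)
  have hgσ : gmin p (σ + 1) σ = fmin p (σ + 1) σ + 1 := by
    rw [Nat.add_sub_cancel] at h2
    rw [h2]
    exact gmin_pred (by omega)
  have hgσ' : gmin p (σ + 1) (σ + 1) = fmin p (σ + 1) (σ + 1) := by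
    rw [gmin_of_le le_rfl, fmin_of_le le_rfl]
  have hfσ : 1 ≤ fmin p (σ + 1) σ :=
    one_le_of_fill (fun _ => fmin_of_lt) (one_le_fmin hw) (Nat.le_succ σ)
  have hg : ∀ t < σ, gmin p (σ + 1) t = minusMinus (gmin p (σ + 1) (t + 1)).toNat (t + 1) :=
    fun t ht => gmin_of_lt ht
  have hgw : ∀ t, σ < t → gmin p (σ + 1) t = w t := fun t ht => by
    rw [gmin_of_le ht, hw.2.2.1 t ht]
  have hg1 : 1 ≤ gmin p (σ + 1) σ := by omega
  have hmono : (nderiv (fmin p (σ + 1)) σ).toNat ≤ (nderiv (gmin p (σ + 1)) σ).toNat := by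
    obtain ⟨τ, rfl⟩ : ∃ i, σ = i + 1 := ⟨σ - 1, by omega⟩
    rw [nderiv_of_fill hg hg1 (Nat.lt_add_one τ),
      nderiv_of_fill (fun _ => fmin_of_lt) (one_le_fmin hw) (by omega)]
    refine green_mono _ ?_
    omega
  refine ⟨oSeq_of_fill hw.1 hσ hg hgw hg1 ?_, oSeq_nderiv_of_fill hw.2.1 hg hgw hg1 ?_ ?_,
    fun _ => gmin_of_le, fun ρ' h' => ?_⟩
  · rw [hgσ', hgσ]
    exact (hf.2.2 σ hσ).trans (mod_cast plusPlus_mono hσ (Int.toNat_le_toNat (by omega)))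
  · rw [Nat.add_sub_cancel] at h2 hle
    omega
  · have h3 := hf'.2.2 σ hσ
    have h4 : nderiv (gmin p (σ + 1)) (σ + 1) ≤ nderiv (fmin p (σ + 1)) (σ + 1) := by
      rw [nderiv, nderiv]; omega
    exact (h4.trans h3).trans (mod_cast plusPlus_mono hσ hmono)
  · by_contra hlt
    have h3 := h' σ (by omega)
    rw [Nat.add_sub_cancel] at h2
    omega

lemma mReg_gmin_le (hw : w ∈ Fset p ρ) (h : ¬ IsRegOf p (fmin p ρ) ρ) :
    mReg (gmin p ρ) ≤ mReg w := by
  have hg := gmin_mem_fset hw h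
  have hρ := (fmin_pred_of_not_isRegOf hw h).1
  refine mReg_le_of_le hw (by omega) hg.1.2.1 hg.2.1 (fun _ => gmin_of_le) ?_
  rw [gmin_pred (by omega)]
  exact eval_pred_lt hw h

lemma mRho_le (hw : w ∈ Fset p ρ) : mRho p ρ ≤ mReg w := Nat.sInf_le ⟨w, hw, rfl⟩

lemma exists_mReg_eq_mRho (hw : w ∈ Fset p ρ) : ∃ u ∈ Fset p ρ, mReg u = mRho p ρ :=
  Nat.sInf_mem (s := Mset p ρ) ⟨_, w, hw, rfl⟩

end Minimal

/-- Corollary `cor:uso innesto`.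
Let `ρ` be an integer with `F(p,ρ) ≠ ∅` and `w ∈ F(p,ρ)`. For every `q ∈ F(p)` one has
`m_w ≤ max{ρ+2, m_q+1}`. If moreover `q ∈ F(p,ρ)`, then:
(i) `m_q < m_w ↔ (m_q = ρ+1 ∧ m_w = ρ+2 ∧ q(ρ-1) < w(ρ-1))`;
(ii) either `M(p,ρ)` is a singleton or `M(p,ρ) = {ρ+1, ρ+2}`;
(iii) `m^ρ_p ≥ m_{f^ρ_p}`, with `m^ρ_p = m_{f^ρ_p}` if `f^ρ_p` has regularity `ρ` and
`m^ρ_p = m_{g^ρ_p}` otherwise. -/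
theorem statement12 (p : GotzmannPoly) (hr : 1 < p.r) (ρ : ℕ)
    (w : ℕ → ℤ) (hw : w ∈ Fset p ρ) :
    (∀ (ρ'' : ℕ) (q : ℕ → ℤ), q ∈ Fset p ρ'' → mReg w ≤ max (ρ + 2) (mReg q + 1)) ∧
    (∀ q ∈ Fset p ρ,
      (mReg q < mReg w ↔ mReg q = ρ + 1 ∧ mReg w = ρ + 2 ∧ q (ρ - 1) < w (ρ - 1))) ∧
    ((∃ a : ℕ, Mset p ρ = {a}) ∨ Mset p ρ = {ρ + 1, ρ + 2}) ∧
    (mReg (fmin p ρ) ≤ mRho p ρ ∧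
      (IsRegOf p (fmin p ρ) ρ → mRho p ρ = mReg (fmin p ρ)) ∧
      (¬ IsRegOf p (fmin p ρ) ρ → mRho p ρ = mReg (gmin p ρ))) := by
  refine ⟨fun ρ' q hq => ?_, fun q hq => mReg_lt_iff hw hq, mset_eq hw, ?_, ?_, ?_⟩
  · have h : ρ' ≤ mReg q := by
      rcases Nat.eq_zero_or_pos ρ' with rfl | hρ
      · exact Nat.zero_le _
      · exact (Nat.le_succ ρ').trans (lt_mReg hq hρ)
    have h' : 1 ≤ ρ' → ρ' + 1 ≤ mReg q := lt_mReg hq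
    have := mReg_le_of_succ_le hw hq (s := max (ρ + 1) (mReg q)) (by omega) (by omega) (by omega)
    omega
  · obtain ⟨u, hu, h⟩ := exists_mReg_eq_mRho hw
    exact h ▸ mReg_fmin_le hu
  · intro h
    obtain ⟨u, hu, h'⟩ := exists_mReg_eq_mRho hw
    refine le_antisymm ?_ (h' ▸ mReg_fmin_le hu)
    rcases Nat.eq_zero_or_pos ρ with rfl | hρ
    · rw [show fmin p 0 = w from funext fun t => by
        rw [fmin_of_le (Nat.zero_le t), hw.2.2.1 t (Nat.zero_le t)]]
      exact mRho_le hw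
    · exact mRho_le ⟨oSeq_fmin hw hρ, oSeq_nderiv_fmin hw hρ, h⟩
  · intro h
    obtain ⟨u, hu, h'⟩ := exists_mReg_eq_mRho hw
    exact le_antisymm (mRho_le (gmin_mem_fset hw h)) (h' ▸ mReg_gmin_le hu h)
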